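/- Let N ≥ 3, 1 < p < ∞, and 1 < s < 2, and suppose that either s + 2/N < 1 + max{1, N/p}, or s + 2/N = 1 + max{1, N/p} and p > N (these are exactly the conditions under which B(s,p) is not locally embedded in B(2−2/N, N)). Then there exist a sequence u_k ∈ C_c^∞(ℝ^N) and a test function φ ∈ C_c^∞(ℝ^N) such that ‖u_k‖_{s,p} → 0 as k → ∞ and ∫_{ℝ^N} det(D²u_k) φ dx → ∞ as k → ∞. -/

import Mathlib

open MeasureTheory Real Filter

noncomputable section

abbrev Eu (N : ℕ) : Type := EuclideanSpace ℝ (Fin N)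

def ebasis {N : ℕ} (i : Fin N) : Eu N := EuclideanSpace.single i 1

/-- Partial derivative `∂ᵢ u (x)`. -/
def pd {N : ℕ} (u : Eu N → ℝ) (i : Fin N) (x : Eu N) : ℝ :=
  fderiv ℝ u x (ebasis i)

/-- Second partial derivative `∂ᵢ∂ⱼ u (x)`. -/
def pd2 {N : ℕ} (u : Eu N → ℝ) (i j : Fin N) (x : Eu N) : ℝ :=
  fderiv ℝ (fun y => fderiv ℝ u y (ebasis j)) x (ebasis i)

/-- The determinant of the Hessian matrix `det (D²u)(x)`. -/
def hessDet {N : ℕ} (u : Eu N → ℝ) (x : Eu N) : ℝ :=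
  (Matrix.of fun i j => pd2 u i j x).det

/-- The Besov norm `‖u‖_{s,p}`. -/
def besov (N : ℕ) (s p : ℝ) (u : Eu N → ℝ) : ℝ :=
  (∫ x : Eu N, |u x| ^ p) ^ (1/p)
  + (∫ x : Eu N, ‖fderiv ℝ u x‖ ^ p) ^ (1/p)
  + (∫ x : Eu N, ∫ y : Eu N,
      ‖fderiv ℝ u x - fderiv ℝ u y‖ ^ p / ‖x - y‖ ^ ((N : ℝ) + (s-1)*p)) ^ (1/p)


/-- smooth compactly supported weight whose `2π`-translates sum to one. -/
def psi (t : ℝ) : ℝ := Real.smoothTransition t - Real.smoothTransition (t - 2 * π)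

lemma psi_contDiff : ContDiff ℝ (⊤ : ℕ∞) psi := by
  unfold psi
  exact Real.smoothTransition.contDiff.sub
    (Real.smoothTransition.contDiff.comp (contDiff_id.sub contDiff_const))

lemma psi_zero_left {t : ℝ} (h : t ≤ 0) : psi t = 0 := by
  unfold psi
  rw [Real.smoothTransition.zero_of_nonpos h, Real.smoothTransition.zero_of_nonpos, sub_zero]
  linarith [Real.pi_pos]

lemma psi_zero_right {t : ℝ} (h : 1 + 2 * π ≤ t) : psi t = 0 := by
  unfold psi
  rw [Real.smoothTransition.one_of_one_le, Real.smoothTransition.one_of_one_le, sub_self]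
  · linarith
  · linarith [Real.pi_pos]

lemma psi_ne_mem {t : ℝ} (h : psi t ≠ 0) : t ∈ Set.Icc (0:ℝ) (1 + 2 * π) := by
  constructor
  · by_contra h'; exact h (psi_zero_left (by linarith))
  · by_contra h'; exact h (psi_zero_right (by linarith))

lemma psi_abs_le {t : ℝ} (h : psi t ≠ 0) : |t| ≤ 8 := by
  have := psi_ne_mem h
  have h1 := this.1
  have h2 := this.2
  rw [abs_of_nonneg h1]
  linarith [Real.pi_lt_d2]

lemma psi_hasCompactSupport : HasCompactSupport psi :=
  HasCompactSupport.of_support_subset_isCompact isCompact_Icc (fun _ h => psi_ne_mem h)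

lemma psi_continuous : Continuous psi := psi_contDiff.continuous

lemma psi_integral_periodic (f : ℝ → ℂ) (hf : Continuous f) (hper : Function.Periodic f (2 * π)) :
    ∫ t, (psi t : ℂ) * f t = ∫ t in (0:ℝ)..(2 * π), f t := by
  have hpi := Real.pi_pos
  have hS : Continuous fun t : ℝ => ((Real.smoothTransition t : ℝ) : ℂ) :=
    Complex.continuous_ofReal.comp Real.smoothTransition.continuous
  have hS2 : Continuous fun t : ℝ => ((Real.smoothTransition (t - 2 * π) : ℝ) : ℂ) :=
    hS.comp (continuous_id.sub continuous_const)
  have e1 : ∫ t, (psi t : ℂ) * f t = ∫ t in (0:ℝ)..(1 + 2 * π), (psi t : ℂ) * f t := by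
    rw [intervalIntegral.integral_of_le (by positivity)]
    rw [MeasureTheory.setIntegral_eq_integral_of_forall_compl_eq_zero]
    intro t ht
    by_cases h0 : psi t = 0
    · simp [h0]
    · exfalso
      have := psi_ne_mem h0
      apply ht
      refine ⟨lt_of_le_of_ne this.1 ?_, this.2⟩
      rintro rfl
      exact h0 (psi_zero_left le_rfl)
  rw [e1]
  have e2 : ∫ t in (0:ℝ)..(1 + 2 * π), (psi t : ℂ) * f t
      = (∫ t in (0:ℝ)..(1 + 2 * π), (Real.smoothTransition t : ℂ) * f t)
        - ∫ t in (0:ℝ)..(1 + 2 * π), (Real.smoothTransition (t - 2 * π) : ℂ) * f t := by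
    rw [← intervalIntegral.integral_sub]
    · congr 1; ext t; simp [psi, sub_mul]
    · exact (hS.mul hf).intervalIntegrable _ _
    · exact (hS2.mul hf).intervalIntegrable _ _
  have e3 : ∫ t in (0:ℝ)..(1 + 2 * π), (Real.smoothTransition (t - 2 * π) : ℂ) * f t
      = ∫ t in (0:ℝ)..1, (Real.smoothTransition t : ℂ) * f t := by
    have h1 : ∫ t in (0:ℝ)..(1 + 2 * π), (Real.smoothTransition (t - 2 * π) : ℂ) * f t
      = ∫ t in (0:ℝ)..(1 + 2 * π), (fun s => (Real.smoothTransition s : ℂ) * f s) (t - 2 * π) := by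
      congr 1; ext t
      simp only [hper.sub_eq]
    rw [h1, intervalIntegral.integral_comp_sub_right (fun s => (Real.smoothTransition s : ℂ) * f s)]
    rw [← intervalIntegral.integral_add_adjacent_intervals (b := 0)]
    · have : ∫ (x : ℝ) in (0 - 2 * π)..0, (Real.smoothTransition x : ℂ) * f x = 0 := by
        rw [intervalIntegral.integral_congr (g := fun _ => 0)]
        · simp
        · intro x hx
          rw [Set.uIcc_of_le (by linarith)] at hx
          simp [Real.smoothTransition.zero_of_nonpos hx.2]
      rw [this, zero_add]
      congr 1; ring
    · exact (hS.mul hf).intervalIntegrable _ _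
    · exact (hS.mul hf).intervalIntegrable _ _
  rw [e2, e3, ← intervalIntegral.integral_add_adjacent_intervals (a := 0) (b := 1) (c := 1 + 2 * π),
    add_sub_cancel_left]
  · rw [intervalIntegral.integral_congr (g := f)]
    · have := hper.intervalIntegral_add_eq 1 0
      rw [this, zero_add]
    · intro x hx
      rw [Set.uIcc_of_le (by linarith)] at hx
      simp [Real.smoothTransition.one_of_one_le hx.1]
  · exact (hS.mul hf).intervalIntegrable _ _
  · exact (hS.mul hf).intervalIntegrable _ _

lemma psi_exp (k : ℤ) :
    ∫ t, (psi t : ℂ) * Complex.exp (Complex.I * k * t) = if k = 0 then 2 * π else 0 := by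
  rw [psi_integral_periodic]
  · split_ifs with h
    · simp [h]
    · have hc : Complex.I * k ≠ 0 := by simp [h]
      rw [integral_exp_mul_complex hc]
      have : Complex.exp (Complex.I * k * ((2 * π : ℝ) : ℂ)) = 1 := by
        rw [Complex.exp_eq_one_iff]
        exact ⟨k, by push_cast; ring⟩
      rw [this]; simp
  · fun_prop
  · intro t
    have : Complex.I * k * ((t + 2 * π : ℝ) : ℂ) = Complex.I * k * t + k * (2 * π * Complex.I) := by
      push_cast; ring
    simp only [this]
    rw [Complex.exp_add, Complex.exp_int_mul_two_pi_mul_I, mul_one]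

lemma psi_mul_integrable (f : ℝ → ℂ) (hf : Continuous f) :
    Integrable (fun t => (psi t : ℂ) * f t) := by
  apply Continuous.integrable_of_hasCompactSupport
  · exact (Complex.continuous_ofReal.comp psi_continuous).mul hf
  · apply HasCompactSupport.mul_right
    exact psi_hasCompactSupport.comp_left (g := fun x : ℝ => (x : ℂ)) (by simp)

lemma psi_sin_exp (m n : ℕ) (hm : 0 < m) (hn : 0 < n) :
    ∫ t, (psi t : ℂ) * ((Real.sin (m * t) : ℂ) * Complex.exp (Complex.I * n * t))
      = if m = n then Complex.I * π else 0 := by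
  have e : ∀ t : ℝ, (psi t : ℂ) * ((Real.sin (m * t) : ℂ) * Complex.exp (Complex.I * n * t))
      = (Complex.I / 2) * ((psi t : ℂ) * Complex.exp (Complex.I * ((n - m : ℤ) : ℂ) * t))
        - (Complex.I / 2) * ((psi t : ℂ) * Complex.exp (Complex.I * ((n + m : ℤ) : ℂ) * t)) := by
    intro t
    have h1 : Complex.exp (Complex.I * ((n - m : ℤ) : ℂ) * t)
      = Complex.exp (-(m * t) * Complex.I) * Complex.exp (Complex.I * n * t) := by
      rw [← Complex.exp_add]; push_cast; congr 1; ring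
    have h2 : Complex.exp (Complex.I * ((n + m : ℤ) : ℂ) * t)
      = Complex.exp ((m * t) * Complex.I) * Complex.exp (Complex.I * n * t) := by
      rw [← Complex.exp_add]; push_cast; congr 1; ring
    rw [h1, h2]
    push_cast
    rw [Complex.sin]
    ring
  simp_rw [e]
  rw [integral_sub, integral_const_mul, integral_const_mul, psi_exp, psi_exp]
  · have h2 : ¬ ((n:ℤ) + m = 0) := by omega
    have h3 : ((n:ℤ) - m = 0) ↔ m = n := by omega
    simp only [h2, h3, if_false]
    split_ifs <;> push_cast <;> ring
  · exact (psi_mul_integrable _ (by fun_prop)).const_mul _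
  · exact (psi_mul_integrable _ (by fun_prop)).const_mul _

lemma psi_cos_exp (m n : ℕ) (hm : 0 < m) :
    ∫ t, (psi t : ℂ) * ((Real.cos (m * t) : ℂ) * Complex.exp (Complex.I * n * t))
      = if m = n then (π : ℂ) else 0 := by
  have e : ∀ t : ℝ, (psi t : ℂ) * ((Real.cos (m * t) : ℂ) * Complex.exp (Complex.I * n * t))
      = (1 / 2) * ((psi t : ℂ) * Complex.exp (Complex.I * ((n - m : ℤ) : ℂ) * t))
        + (1 / 2) * ((psi t : ℂ) * Complex.exp (Complex.I * ((n + m : ℤ) : ℂ) * t)) := by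
    intro t
    have h1 : Complex.exp (Complex.I * ((n - m : ℤ) : ℂ) * t)
      = Complex.exp (-(m * t) * Complex.I) * Complex.exp (Complex.I * n * t) := by
      rw [← Complex.exp_add]; push_cast; congr 1; ring
    have h2 : Complex.exp (Complex.I * ((n + m : ℤ) : ℂ) * t)
      = Complex.exp ((m * t) * Complex.I) * Complex.exp (Complex.I * n * t) := by
      rw [← Complex.exp_add]; push_cast; congr 1; ring
    rw [h1, h2]
    push_cast
    rw [Complex.cos]
    ring
  simp_rw [e]
  rw [integral_add, integral_const_mul, integral_const_mul, psi_exp, psi_exp]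
  · have h2 : ¬ ((n:ℤ) + m = 0) := by omega
    have h3 : ((n:ℤ) - m = 0) ↔ m = n := by omega
    simp only [h2, h3, if_false]
    split_ifs <;> push_cast <;> ring
  · exact (psi_mul_integrable _ (by fun_prop)).const_mul _
  · exact (psi_mul_integrable _ (by fun_prop)).const_mul _

lemma psi_integral : ∫ t, psi t = 2 * π := by
  have := psi_exp 0
  simp only [Int.cast_zero, mul_zero, zero_mul, Complex.exp_zero, mul_one, if_true] at this
  rw [integral_complex_ofReal] at this
  exact_mod_cast this


open Matrix in
/-- determinant of the bordered matrix -/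
lemma det_bordered_aux {ι : Type*} [Fintype ι] [DecidableEq ι] (z o : ι) (hzo : o ≠ z)
    (a : ι → ℝ) (haz : a z = 1) (ha : ∀ i, a i ≠ 0) (β γ δ : ℝ) :
    (Matrix.of fun i k : ι => (if i = k then a i else 0)
      + β * (if i = z then 0 else 1) * (if k = z then 0 else 1)
      + ((if i = o then γ else 0) + δ * (if i = z then 0 else 1)) * (if k = z then 1 else 0)
      + (if i = z then 1 else 0) * ((if k = o then γ else 0) + δ * (if k = z then 0 else 1))
      - (if i = z then 1 else 0) * (if k = z then 1 else 0)).det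
    = - (γ ^ 2 + 2 * γ * δ) * ∏ i ∈ (Finset.univ.erase z).erase o, a i
      - δ ^ 2 * ∑ j ∈ Finset.univ.erase z, ∏ i ∈ (Finset.univ.erase z).erase j, a i
      - β * γ ^ 2 * ∑ j ∈ (Finset.univ.erase z).erase o,
          ∏ i ∈ ((Finset.univ.erase z).erase o).erase j, a i := by
  set t : ι → ℝ := fun i => if i = z then 0 else 1 with ht
  set b : ι → ℝ := fun i => (if i = o then γ else 0) + δ * (if i = z then 0 else 1) with hb
  set ζ : ι → ℝ := fun i => if i = z then 1 else 0 with hζ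
  set U : Matrix ι (Fin 3) ℝ := Matrix.of fun i => ![t i, b i, ζ i] with hU
  set V : Matrix (Fin 3) ι ℝ := Matrix.of ![fun i => β * t i, ζ, fun i => b i - ζ i] with hV
  set E : Finset ι := Finset.univ.erase z with hE
  have hoE : o ∈ E := by simp [hE, hzo]
  have e1 : (Matrix.of fun i k : ι => (if i = k then a i else 0)
      + β * (if i = z then 0 else 1) * (if k = z then 0 else 1)
      + ((if i = o then γ else 0) + δ * (if i = z then 0 else 1)) * (if k = z then 1 else 0)
      + (if i = z then 1 else 0) * ((if k = o then γ else 0) + δ * (if k = z then 0 else 1))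
      - (if i = z then 1 else 0) * (if k = z then 1 else 0))
      = Matrix.diagonal a * (1 + (Matrix.diagonal (fun i => (a i)⁻¹) * U) * V) := by
    rw [mul_add, mul_one, Matrix.mul_assoc, ← Matrix.mul_assoc, Matrix.diagonal_mul_diagonal]
    have : (fun i => a i * (a i)⁻¹) = fun _ => 1 := by
      ext i; exact mul_inv_cancel₀ (ha i)
    rw [this]
    ext i k
    simp only [Matrix.of_apply, Matrix.add_apply, Matrix.diagonal_apply, Matrix.mul_apply, Matrix.diagonal_one,
      Matrix.one_mul, Fin.sum_univ_three, hU, hV, ht, hb, hζ, Matrix.cons_val_zero, Matrix.cons_val_one, Matrix.cons_val]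
    ring
  set s0 : ℝ := ∑ i ∈ E, (a i)⁻¹ with hs0
  have key : ∀ f g : ι → ℝ, ∑ i, f i * ((a i)⁻¹ * g i) = f z * g z + ∑ i ∈ E, f i * ((a i)⁻¹ * g i) := by
    intro f g
    rw [hE, ← Finset.add_sum_erase _ _ (Finset.mem_univ z), haz]; simp
  have tz : t z = 0 := by simp [ht]
  have zz : ζ z = 1 := by simp [hζ]
  have bz : b z = 0 := by simp [hb, hzo.symm]
  have tE : ∀ i ∈ E, t i = 1 := by intro i hi; simp [hE] at hi; simp [ht, hi]
  have zE : ∀ i ∈ E, ζ i = 0 := by intro i hi; simp [hE] at hi; simp [hζ, hi]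
  have bE : ∀ i ∈ E, b i = (if i = o then γ else 0) + δ := by
    intro i hi; simp [hE] at hi; simp [hb, hi]
  have p1 : ∑ i ∈ E, t i * ((a i)⁻¹ * t i) = s0 := by
    apply Finset.sum_congr rfl; intro i hi; rw [tE i hi]; ring
  have p2 : ∑ i ∈ E, t i * ((a i)⁻¹ * b i) = δ * s0 + γ * (a o)⁻¹ := by
    have : ∀ i ∈ E, t i * ((a i)⁻¹ * b i) = δ * (a i)⁻¹ + (if i = o then γ * (a i)⁻¹ else 0) := by
      intro i hi; rw [tE i hi, bE i hi]; split_ifs <;> ring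
    rw [Finset.sum_congr rfl this, Finset.sum_add_distrib, ← Finset.mul_sum, Finset.sum_ite_eq' , if_pos hoE]
  have p2' : ∑ i ∈ E, (b i - ζ i) * ((a i)⁻¹ * t i) = δ * s0 + γ * (a o)⁻¹ := by
    rw [← p2]; apply Finset.sum_congr rfl; intro i hi; rw [zE i hi]; ring
  have p3 : ∑ i ∈ E, (b i - ζ i) * ((a i)⁻¹ * b i) = δ ^ 2 * s0 + (γ ^ 2 + 2 * γ * δ) * (a o)⁻¹ := by
    have : ∀ i ∈ E, (b i - ζ i) * ((a i)⁻¹ * b i) = δ ^ 2 * (a i)⁻¹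
        + (if i = o then (γ ^ 2 + 2 * γ * δ) * (a i)⁻¹ else 0) := by
      intro i hi; rw [zE i hi, bE i hi]; split_ifs <;> ring
    rw [Finset.sum_congr rfl this, Finset.sum_add_distrib, ← Finset.mul_sum, Finset.sum_ite_eq' , if_pos hoE]
  have z1 : ∀ g : ι → ℝ, ∑ i ∈ E, ζ i * ((a i)⁻¹ * g i) = 0 := by
    intro g; apply Finset.sum_eq_zero; intro i hi; rw [zE i hi]; ring
  have z2 : ∀ g : ι → ℝ, ∑ i ∈ E, g i * ((a i)⁻¹ * ζ i) = 0 := by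
    intro g; apply Finset.sum_eq_zero; intro i hi; rw [zE i hi]; ring
  rw [e1, Matrix.det_mul, Matrix.det_diagonal, Matrix.det_one_add_mul_comm]
  have e2 : (1 + V * (Matrix.diagonal (fun i => (a i)⁻¹) * U) : Matrix (Fin 3) (Fin 3) ℝ)
      = !![1 + β * s0, β * (δ * s0 + γ * (a o)⁻¹), 0; 0, 1, 1;
          δ * s0 + γ * (a o)⁻¹, δ ^ 2 * s0 + (γ ^ 2 + 2 * γ * δ) * (a o)⁻¹, 0] := by
    have kb : ∀ g : ι → ℝ, ∑ i, β * t i * ((a i)⁻¹ * g i) = β * ∑ i, t i * ((a i)⁻¹ * g i) := by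
      intro g; rw [Finset.mul_sum]; apply Finset.sum_congr rfl; intros; ring
    have kd : ∀ g : ι → ℝ, ∑ i, (b i - ζ i) * ((a i)⁻¹ * g i)
      = (b z - ζ z) * g z + ∑ i ∈ E, (b i - ζ i) * ((a i)⁻¹ * g i) := fun g => key (fun i => b i - ζ i) g
    have z2' : ∑ i ∈ E, (b i - ζ i) * ((a i)⁻¹ * ζ i) = 0 := z2 (fun i => b i - ζ i)
    have U0 : ∀ k, U k 0 = t k := fun k => rfl
    have U1 : ∀ k, U k 1 = b k := fun k => rfl
    have U2 : ∀ k, U k 2 = ζ k := fun k => rfl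
    have V0 : ∀ k, V 0 k = β * t k := fun k => rfl
    have V1 : ∀ k, V 1 k = ζ k := fun k => rfl
    have V2 : ∀ k, V 2 k = b k - ζ k := fun k => rfl
    ext i j
    rw [Matrix.add_apply, Matrix.mul_apply]
    simp only [Matrix.diagonal_mul]
    clear_value U V t b ζ
    fin_cases i <;> fin_cases j <;>
      simp [U0, U1, U2, V0, V1, V2, kb, kd, key, tz, zz, bz, p1, p2, p2', p3, z1, z2]
  rw [e2, Matrix.det_fin_three]
  simp only [Matrix.of_apply, Matrix.cons_val', Matrix.cons_val_zero, Matrix.cons_val_one, Matrix.cons_val]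
  have q0 : ∏ i, a i = ∏ i ∈ E, a i := by
    rw [hE, ← Finset.mul_prod_erase _ _ (Finset.mem_univ z), haz, one_mul]
  have q1 : ∏ i ∈ E, a i = a o * ∏ i ∈ E.erase o, a i := (Finset.mul_prod_erase _ _ hoE).symm
  have q2 : ∀ F : Finset ι, ∑ j ∈ F, ∏ i ∈ F.erase j, a i = (∏ i ∈ F, a i) * ∑ j ∈ F, (a j)⁻¹ := by
    intro F
    rw [Finset.mul_sum]
    apply Finset.sum_congr rfl
    intro j hj
    rw [← Finset.mul_prod_erase _ _ hj]
    field_simp [ha j]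
  have q3 : s0 = (a o)⁻¹ + ∑ j ∈ E.erase o, (a j)⁻¹ := (Finset.add_sum_erase _ _ hoE).symm
  rw [q2, q2, q0, q1, ← hs0, q3]
  have hao := ha o
  field_simp
  ring

/-- determinant of the bordered matrix, general -/
lemma det_bordered {ι : Type*} [Fintype ι] [DecidableEq ι] (z o : ι) (hzo : o ≠ z)
    (a : ι → ℝ) (β γ δ : ℝ) :
    (Matrix.of fun i k : ι => (if i = k then (if i = z then 0 else a i) else 0)
      + β * (if i = z then 0 else 1) * (if k = z then 0 else 1)
      + ((if i = o then γ else 0) + δ * (if i = z then 0 else 1)) * (if k = z then 1 else 0)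
      + (if i = z then 1 else 0) * ((if k = o then γ else 0) + δ * (if k = z then 0 else 1))).det
    = - (γ ^ 2 + 2 * γ * δ) * ∏ i ∈ (Finset.univ.erase z).erase o, a i
      - δ ^ 2 * ∑ j ∈ Finset.univ.erase z, ∏ i ∈ (Finset.univ.erase z).erase j, a i
      - β * γ ^ 2 * ∑ j ∈ (Finset.univ.erase z).erase o,
          ∏ i ∈ ((Finset.univ.erase z).erase o).erase j, a i := by
  set a' : ℝ → ι → ℝ := fun t i => if i = z then 1 else a i + t with ha'
  have hz : ∀ t, a' t z = 1 := by intro t; simp [ha']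
  set L : ℝ → ℝ := fun t => (Matrix.of fun i k : ι => (if i = k then a' t i else 0)
      + β * (if i = z then 0 else 1) * (if k = z then 0 else 1)
      + ((if i = o then γ else 0) + δ * (if i = z then 0 else 1)) * (if k = z then 1 else 0)
      + (if i = z then 1 else 0) * ((if k = o then γ else 0) + δ * (if k = z then 0 else 1))
      - (if i = z then 1 else 0) * (if k = z then 1 else 0)).det with hL
  set R : ℝ → ℝ := fun t => - (γ ^ 2 + 2 * γ * δ) * ∏ i ∈ (Finset.univ.erase z).erase o, a' t i
      - δ ^ 2 * ∑ j ∈ Finset.univ.erase z, ∏ i ∈ (Finset.univ.erase z).erase j, a' t i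
      - β * γ ^ 2 * ∑ j ∈ (Finset.univ.erase z).erase o,
          ∏ i ∈ ((Finset.univ.erase z).erase o).erase j, a' t i with hR
  have hc : ∀ i, Continuous fun t => a' t i := by
    intro i; simp only [ha']; split_ifs <;> fun_prop
  have hLc : Continuous L := by
    apply Continuous.matrix_det
    apply continuous_matrix
    intro i k
    simp only [Matrix.of_apply]
    have : Continuous fun t => if i = k then a' t i else 0 := by
      split_ifs
      · exact hc i
      · fun_prop
    fun_prop
  have hRc : Continuous R := by
    simp only [hR]
    have : ∀ F : Finset ι, Continuous fun t => ∏ i ∈ F, a' t i :=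
      fun F => continuous_finsetProd _ (fun i _ => hc i)
    fun_prop
  have hdense : Dense ((Finset.univ.image (fun i => - a i) : Finset ℝ) : Set ℝ)ᶜ :=
    (Set.Countable.dense_compl ℝ (Finset.countable_toSet _))
  have hEq : L = R := by
    apply Continuous.ext_on hdense hLc hRc
    intro t ht
    apply det_bordered_aux z o hzo (a' t) (hz t)
    intro i
    simp only [ha']
    split_ifs
    · norm_num
    · intro h
      apply ht
      simp only [Finset.coe_image, Finset.coe_univ, Set.image_univ, Set.mem_range]
      exact ⟨i, by linarith⟩
  have h0 := congrFun hEq 0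
  have hprod : ∀ F : Finset ι, z ∉ F → ∏ i ∈ F, a' 0 i = ∏ i ∈ F, a i := by
    intro F hF
    apply Finset.prod_congr rfl
    intro i hi
    have : i ≠ z := fun h => hF (h ▸ hi)
    simp [ha', this]
  simp only [hR] at h0
  rw [hprod _ (by simp), Finset.sum_congr rfl (fun j _ => hprod _ (by simp)),
    Finset.sum_congr rfl (fun j _ => hprod (((Finset.univ.erase z).erase o).erase j) (by simp))] at h0
  rw [← h0, hL]
  congr 1
  ext i k
  simp only [Matrix.of_apply, ha']
  clear h0 hprod hEq hRc hLc hdense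
  by_cases h3 : i = k
  · subst h3
    by_cases h1 : i = z <;> simp [h1, hzo.symm]
  · by_cases h1 : i = z
    · have h2 : k ≠ z := fun h => h3 (h1.trans h.symm)
      simp [h3, h2]
    · simp [h3, h1]


section hess
variable {N : ℕ}

/-- sum of all coordinates but `z` -/
def TT (z : Fin N) : Eu N →L[ℝ] ℝ := ∑ i ∈ Finset.univ.erase z, EuclideanSpace.proj i

lemma TT_apply (z : Fin N) (x : Eu N) : TT z x = ∑ i ∈ Finset.univ.erase z, x i := by
  simp [TT]

/-- the oscillating profile -/
def UU (z o : Fin N) (v : ℝ → ℝ) (x : Eu N) : ℝ :=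
  x z * (v (x o) - v (TT z x)) - ∑ j ∈ (Finset.univ.erase z).erase o, v (x j)

lemma hasFDerivAt_comp_proj {v v1 : ℝ → ℝ} (hv : ∀ t, HasDerivAt v (v1 t) t) (L : Eu N →L[ℝ] ℝ)
    (x : Eu N) : HasFDerivAt (fun x => v (L x)) (v1 (L x) • L) x :=
  (hv _).comp_hasFDerivAt x L.hasFDerivAt

lemma hasFDerivAt_UU {v v1 : ℝ → ℝ} (hv : ∀ t, HasDerivAt v (v1 t) t) (z o : Fin N) (x : Eu N) :
    HasFDerivAt (UU z o v)
      (x z • (v1 (x o) • (EuclideanSpace.proj o : Eu N →L[ℝ] ℝ) - v1 (TT z x) • TT z)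
        + (v (x o) - v (TT z x)) • (EuclideanSpace.proj z : Eu N →L[ℝ] ℝ)
        - ∑ j ∈ (Finset.univ.erase z).erase o, v1 (x j) • (EuclideanSpace.proj j : Eu N →L[ℝ] ℝ)) x := by
  have hz : HasFDerivAt (fun x : Eu N => x z) (EuclideanSpace.proj z : Eu N →L[ℝ] ℝ) x :=
    (EuclideanSpace.proj z : Eu N →L[ℝ] ℝ).hasFDerivAt
  have h1 := hasFDerivAt_comp_proj hv (EuclideanSpace.proj o : Eu N →L[ℝ] ℝ) x
  have h2 := hasFDerivAt_comp_proj hv (TT z) x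
  have h3 : HasFDerivAt (fun x : Eu N => ∑ j ∈ (Finset.univ.erase z).erase o, v (x j))
      (∑ j ∈ (Finset.univ.erase z).erase o, v1 (x j) • (EuclideanSpace.proj j : Eu N →L[ℝ] ℝ)) x := by
    apply HasFDerivAt.fun_sum
    intro j _
    exact hasFDerivAt_comp_proj hv (EuclideanSpace.proj j : Eu N →L[ℝ] ℝ) x
  exact (hz.mul (h1.sub h2)).sub h3

lemma proj_ebasis (i j : Fin N) : (ebasis j : Eu N) i = if i = j then 1 else 0 := by
  simp [ebasis]

lemma TT_ebasis (z j : Fin N) : TT z (ebasis j) = if j = z then 0 else 1 := by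
  rw [TT_apply]
  simp only [proj_ebasis, Finset.sum_ite_eq', Finset.mem_erase, Finset.mem_univ, and_true]
  split_ifs <;> simp_all

lemma pd_UU {v v1 : ℝ → ℝ} (hv : ∀ t, HasDerivAt v (v1 t) t) (z o : Fin N) (j : Fin N) (x : Eu N) :
    fderiv ℝ (UU z o v) x (ebasis j) =
      x z * (v1 (x o) * (if o = j then 1 else 0) - v1 (TT z x) * (if j = z then 0 else 1))
       + (v (x o) - v (TT z x)) * (if z = j then 1 else 0)
       - (if j ∈ (Finset.univ.erase z).erase o then 1 else 0) * v1 (x j) := by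
  rw [(hasFDerivAt_UU hv z o x).fderiv]
  simp [proj_ebasis, TT_ebasis, -Finset.mem_erase]

lemma pd2_UU {v v1 v2 : ℝ → ℝ} (hv : ∀ t, HasDerivAt v (v1 t) t) (hv1 : ∀ t, HasDerivAt v1 (v2 t) t)
    (z o : Fin N) (i j : Fin N) (x : Eu N) :
    pd2 (UU z o v) i j x =
      x z * (v2 (x o) * (if o = i then 1 else 0) * (if o = j then 1 else 0)
          - v2 (TT z x) * (if i = z then 0 else 1) * (if j = z then 0 else 1))
      + (if z = i then 1 else 0) *
        (v1 (x o) * (if o = j then 1 else 0) - v1 (TT z x) * (if j = z then 0 else 1))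
       + (v1 (x o) * (if o = i then 1 else 0) - v1 (TT z x) * (if i = z then 0 else 1))
         * (if z = j then 1 else 0)
       - (if j ∈ (Finset.univ.erase z).erase o then 1 else 0) * (v2 (x j) * (if j = i then 1 else 0)) := by
  unfold pd2
  have e : (fun y => fderiv ℝ (UU z o v) y (ebasis j)) = fun y : Eu N =>
      y z * (v1 (y o) * (if o = j then 1 else 0) - v1 (TT z y) * (if j = z then 0 else 1))
       + (v (y o) - v (TT z y)) * (if z = j then 1 else 0)
       - (if j ∈ (Finset.univ.erase z).erase o then 1 else 0) * v1 (y j) := by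
    ext y; exact pd_UU hv z o j y
  rw [e]
  have hz : HasFDerivAt (fun x : Eu N => x z) (EuclideanSpace.proj z : Eu N →L[ℝ] ℝ) x :=
    (EuclideanSpace.proj z : Eu N →L[ℝ] ℝ).hasFDerivAt
  have h1 := hasFDerivAt_comp_proj hv (EuclideanSpace.proj o : Eu N →L[ℝ] ℝ) x
  have h2 := hasFDerivAt_comp_proj hv (TT z) x
  have k1 := hasFDerivAt_comp_proj hv1 (EuclideanSpace.proj o : Eu N →L[ℝ] ℝ) x
  have k2 := hasFDerivAt_comp_proj hv1 (TT z) x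
  have k3 := hasFDerivAt_comp_proj hv1 (EuclideanSpace.proj j : Eu N →L[ℝ] ℝ) x
  have H := ((hz.mul ((k1.mul_const (if o = j then (1:ℝ) else 0)).sub
    (k2.mul_const (if j = z then (0:ℝ) else 1)))).add
    ((h1.sub h2).mul_const (if z = j then (1:ℝ) else 0))).sub
    (k3.const_mul (if j ∈ (Finset.univ.erase z).erase o then (1:ℝ) else 0))
  have H' := congrArg (fun L : Eu N →L[ℝ] ℝ => L (ebasis i)) H.fderiv
  refine Eq.trans H' ?_
  have pa : ∀ (k : Fin N) (y : Eu N), (EuclideanSpace.proj k : Eu N →L[ℝ] ℝ) y = y k := fun _ _ => rfl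
  simp only [_root_.sub_apply, _root_.add_apply, _root_.smul_apply, Pi.sub_apply, pa, proj_ebasis, TT_ebasis, smul_eq_mul]
  ring

lemma hessDet_UU {v v1 v2 : ℝ → ℝ} (hv : ∀ t, HasDerivAt v (v1 t) t)
    (hv1 : ∀ t, HasDerivAt v1 (v2 t) t) (z o : Fin N) (hzo : o ≠ z) (x : Eu N) :
    hessDet (UU z o v) x =
      (2 * v1 (x o) * v1 (TT z x) - v1 (x o) ^ 2 - v1 (TT z x) ^ 2)
          * ∏ i ∈ (Finset.univ.erase z).erase o, (-v2 (x i))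
      - v1 (TT z x) ^ 2 * ∑ j ∈ (Finset.univ.erase z).erase o,
          x z * v2 (x o) * ∏ i ∈ ((Finset.univ.erase z).erase o).erase j, (-v2 (x i))
      + x z * v2 (TT z x) * v1 (x o) ^ 2 * ∑ j ∈ (Finset.univ.erase z).erase o,
          ∏ i ∈ ((Finset.univ.erase z).erase o).erase j, (-v2 (x i)) := by
  set a : Fin N → ℝ := fun i => if i = o then x z * v2 (x o) else - v2 (x i) with ha
  have H := det_bordered z o hzo a (-(x z * v2 (TT z x))) (v1 (x o)) (- v1 (TT z x))
  have e : hessDet (UU z o v) x = (Matrix.of fun i k : Fin N =>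
      (if i = k then (if i = z then 0 else a i) else 0)
      + (-(x z * v2 (TT z x))) * (if i = z then 0 else 1) * (if k = z then 0 else 1)
      + ((if i = o then v1 (x o) else 0) + (- v1 (TT z x)) * (if i = z then 0 else 1))
          * (if k = z then 1 else 0)
      + (if i = z then 1 else 0) *
        ((if k = o then v1 (x o) else 0) + (- v1 (TT z x)) * (if k = z then 0 else 1))).det := by
    unfold hessDet
    congr 1
    ext i k
    simp only [Matrix.of_apply]
    rw [pd2_UU hv hv1]
    simp only [ha, Finset.mem_erase, Finset.mem_univ, and_true]
    clear H ha a
    generalize v2 (x.ofLp o) = c1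
    generalize v2 (TT z x) = c2
    generalize v1 (x.ofLp o) = c3
    generalize v1 (TT z x) = c4
    generalize x.ofLp z = c5
    have hoz := hzo.symm
    by_cases h1 : i = z
    · subst h1
      by_cases h2 : k = i
      · subst h2; simp [hzo, hoz]
      · have h2' := Ne.symm h2
        by_cases h4 : k = o
        · subst h4; simp [hzo, hoz]; ring
        · have h4' := Ne.symm h4
          simp [h2, h2', h4, h4', hzo, hoz]
    · have h1' := Ne.symm h1
      by_cases h3 : i = o
      · subst h3
        by_cases h2 : k = z
        · subst h2; simp [hzo, hoz]; ring
        · have h2' := Ne.symm h2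
          by_cases h4 : k = i
          · subst h4; simp [hzo, hoz]; ring
          · have h4' := Ne.symm h4
            simp [h2, h2', h4, h4', hzo, hoz]
      · have h3' := Ne.symm h3
        by_cases h2 : k = z
        · subst h2; simp [h1, h1', h3, h3', hzo, hoz]
        · have h2' := Ne.symm h2
          by_cases h4 : k = i
          · subst h4; simp [h1, h1', h3, h3', hzo, hoz]; ring
          · have h4' := Ne.symm h4
            simp [h1, h1', h2, h2', h3, h3', h4, h4']
  rw [e, H]
  have hoE : o ∈ Finset.univ.erase z := by simp [hzo]
  have p1 : ∀ F : Finset (Fin N), o ∉ F → ∏ i ∈ F, a i = ∏ i ∈ F, (-v2 (x i)) := by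
    intro F hF
    apply Finset.prod_congr rfl
    intro i hi
    have : i ≠ o := fun h => hF (h ▸ hi)
    simp [ha, this]
  have p2 : ∑ j ∈ Finset.univ.erase z, ∏ i ∈ (Finset.univ.erase z).erase j, a i
      = ∏ i ∈ (Finset.univ.erase z).erase o, (-v2 (x i)) + ∑ j ∈ (Finset.univ.erase z).erase o,
          x z * v2 (x o) * ∏ i ∈ ((Finset.univ.erase z).erase o).erase j, (-v2 (x i)) := by
    rw [← Finset.add_sum_erase _ _ hoE, p1 _ (by simp)]
    congr 1
    apply Finset.sum_congr rfl
    intro j hj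
    have hjo : o ∈ (Finset.univ.erase z).erase j := by
      simp only [Finset.mem_erase, Finset.mem_univ, and_true] at hj ⊢
      exact ⟨fun h => hj.1 h.symm, hzo⟩
    rw [← Finset.mul_prod_erase _ _ hjo, Finset.erase_right_comm, p1 _ (by simp)]
    simp [ha]
  rw [p2, p1 _ (by simp), Finset.sum_congr rfl
    (fun j _ => p1 (((Finset.univ.erase z).erase o).erase j) (by simp))]
  ring
end hess


section integ
variable {N : ℕ}

/-- product weight -/
def phi (x : Eu N) : ℝ := ∏ i, psi (x i)

lemma phi_contDiff : ContDiff ℝ (⊤ : ℕ∞) (phi : Eu N → ℝ) := by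
  unfold phi
  apply contDiff_prod
  intro i _
  exact psi_contDiff.comp (EuclideanSpace.proj i : Eu N →L[ℝ] ℝ).contDiff

lemma phi_ne {x : Eu N} (h : phi x ≠ 0) (i : Fin N) : |x i| ≤ 8 := by
  apply psi_abs_le
  intro h0
  exact h (Finset.prod_eq_zero (Finset.mem_univ i) h0)

lemma norm_le_of_coord {x : Eu N} (h : ∀ i, |x i| ≤ 8) : ‖x‖ ≤ 8 * N := by
  rw [EuclideanSpace.norm_eq]
  apply Real.sqrt_le_iff.2
  refine ⟨by positivity, ?_⟩
  calc ∑ i, ‖x i‖ ^ 2 ≤ ∑ i : Fin N, (8:ℝ) ^ 2 := by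
        apply Finset.sum_le_sum
        intro i _
        have := h i
        rw [Real.norm_eq_abs]
        gcongr
    _ = N * 8 ^ 2 := by simp
    _ ≤ (8 * N) ^ 2 := by
        rcases Nat.eq_zero_or_pos N with h0 | h0
        · subst h0; simp
        · have : (1:ℝ) ≤ N := by exact_mod_cast h0
          nlinarith

lemma phi_hasCompactSupport : HasCompactSupport (phi : Eu N → ℝ) := by
  apply HasCompactSupport.of_support_subset_isCompact (isCompact_closedBall (0 : Eu N) (8 * N))
  intro x hx
  rw [Metric.mem_closedBall, dist_zero_right]
  exact norm_le_of_coord (phi_ne hx)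

lemma prod_psi_eq (f : Fin N → ℝ → ℝ) (x : Eu N) :
    ∏ i, (psi (x i) * f i (x i)) = phi x * ∏ i, f i (x i) := by
  rw [Finset.prod_mul_distrib, phi]

lemma K_integrable (z : Fin N) (g : ℝ → ℝ) (hg : Continuous g) (f : Fin N → ℝ → ℝ)
    (hf : ∀ i, Continuous (f i)) :
    Integrable (fun x : Eu N => g (TT z x) * ∏ i, (psi (x i) * f i (x i))) := by
  have hc : ∀ i, Continuous fun x : Eu N => f i (x i) := fun i =>
    (hf i).comp (EuclideanSpace.proj i : Eu N →L[ℝ] ℝ).continuous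
  simp_rw [prod_psi_eq]
  apply Continuous.integrable_of_hasCompactSupport
  · exact (hg.comp (TT z).continuous).mul (phi_contDiff.continuous.mul
      (continuous_finsetProd _ fun i _ => hc i))
  · apply HasCompactSupport.mul_left
    exact phi_hasCompactSupport.mul_right

/-- one-dimensional factors -/
def fac (z : Fin N) (k : ℤ) (f : Fin N → ℝ → ℝ) (i : Fin N) : ℂ :=
  ∫ t : ℝ, (psi t : ℂ) * ((f i t : ℂ) * Complex.exp (Complex.I * ((if i = z then 0 else k : ℤ) : ℂ) * t))

lemma K_exp (z : Fin N) (k : ℤ) (f : Fin N → ℝ → ℝ) :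
    ∫ x : Eu N, Complex.exp (Complex.I * k * (TT z x : ℝ)) * ∏ i, ((psi (x i) : ℂ) * (f i (x i) : ℂ))
      = ∏ i, fac z k f i := by
  unfold fac
  rw [← integral_fintype_prod_volume_eq_prod]
  rw [← (EuclideanSpace.volume_preserving_symm_measurableEquiv_toLp (Fin N)).integral_comp
    (MeasurableEquiv.measurableEmbedding _)]
  congr 1
  ext x
  simp only [MeasurableEquiv.coe_toLp_symm]
  have : Complex.exp (Complex.I * k * (TT z x : ℝ))
      = ∏ i, Complex.exp (Complex.I * ((if i = z then 0 else k : ℤ) : ℂ) * (x i : ℝ)) := by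
    rw [← Complex.exp_sum, ← Finset.add_sum_erase _ _ (Finset.mem_univ z)]
    congr 1
    rw [TT_apply]
    push_cast
    rw [Finset.mul_sum]
    simp only [if_true, mul_zero, zero_mul, zero_add]
    apply Finset.sum_congr rfl
    intro i hi
    simp only [Finset.mem_erase] at hi
    simp [hi.1]
  rw [this, ← Finset.prod_mul_distrib]
  apply Finset.prod_congr rfl
  intro i _
  ring

lemma K_exp_integrable (z : Fin N) (k : ℤ) (f : Fin N → ℝ → ℝ) (hf : ∀ i, Continuous (f i)) :
    Integrable (fun x : Eu N =>
      Complex.exp (Complex.I * k * (TT z x : ℝ)) * ∏ i, ((psi (x i) : ℂ) * (f i (x i) : ℂ))) := by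
  have h1 := (K_integrable z (fun t => Real.cos (k * t)) (by fun_prop) f hf).ofReal (𝕜 := ℂ)
  have h2 := ((K_integrable z (fun t => Real.sin (k * t)) (by fun_prop) f hf).ofReal (𝕜 := ℂ)).mul_const Complex.I
  refine (h1.add h2).congr (ae_of_all _ fun x => ?_)
  have : Complex.I * k * (TT z x : ℝ) = ((k * TT z x : ℝ) : ℂ) * Complex.I := by push_cast; ring
  simp only [Pi.add_apply]
  rw [this, Complex.exp_mul_I]
  simp
  ring

lemma K_cos (z : Fin N) (k : ℤ) (f : Fin N → ℝ → ℝ) (hf : ∀ i, Continuous (f i)) :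
    ∫ x : Eu N, Real.cos (k * TT z x) * ∏ i, (psi (x i) * f i (x i)) = (∏ i, fac z k f i).re := by
  rw [← K_exp]
  have := Complex.reCLM.integral_comp_comm (K_exp_integrable z k f hf)
  simp only [Complex.reCLM_apply] at this
  rw [← this]
  congr 1
  ext x
  have e1 : Complex.I * k * (TT z x : ℝ) = ((k * TT z x : ℝ) : ℂ) * Complex.I := by push_cast; ring
  have e2 : ∏ i, ((psi (x i) : ℂ) * (f i (x i) : ℂ)) = ((∏ i, (psi (x i) * f i (x i)) : ℝ) : ℂ) := by
    push_cast; rfl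
  rw [e1, e2, Complex.re_mul_ofReal, Complex.exp_ofReal_mul_I_re]

lemma K_sin (z : Fin N) (k : ℤ) (f : Fin N → ℝ → ℝ) (hf : ∀ i, Continuous (f i)) :
    ∫ x : Eu N, Real.sin (k * TT z x) * ∏ i, (psi (x i) * f i (x i)) = (∏ i, fac z k f i).im := by
  rw [← K_exp]
  have := Complex.imCLM.integral_comp_comm (K_exp_integrable z k f hf)
  simp only [Complex.imCLM_apply] at this
  rw [← this]
  congr 1
  ext x
  have e1 : Complex.I * k * (TT z x : ℝ) = ((k * TT z x : ℝ) : ℂ) * Complex.I := by push_cast; ring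
  have e2 : ∏ i, ((psi (x i) : ℂ) * (f i (x i) : ℂ)) = ((∏ i, (psi (x i) * f i (x i)) : ℝ) : ℂ) := by
    push_cast; rfl
  rw [e1, e2, Complex.im_mul_ofReal, Complex.exp_ofReal_mul_I_im]

lemma fac_zero_of_one (z : Fin N) (k : ℤ) (hk : k ≠ 0) (f : Fin N → ℝ → ℝ) (q : Fin N) (hq : q ≠ z)
    (hfq : ∀ t, f q t = 1) : ∏ i, fac z k f i = 0 := by
  apply Finset.prod_eq_zero (Finset.mem_univ q)
  unfold fac
  simp only [hfq, hq, if_false, Complex.ofReal_one, one_mul]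
  rw [psi_exp, if_neg hk]
  simp

lemma fac_zero_of_mean (z : Fin N) (f : Fin N → ℝ → ℝ) (r : Fin N)
    (hfr : ∫ t, psi t * f r t = 0) : ∏ i, fac z 0 f i = 0 := by
  apply Finset.prod_eq_zero (Finset.mem_univ r)
  unfold fac
  simp only [ite_self, Int.cast_zero, mul_zero, zero_mul, Complex.exp_zero, mul_one]
  have : ∫ t, (psi t : ℂ) * (f r t : ℂ) = ((∫ t, psi t * f r t : ℝ) : ℂ) := by
    rw [← integral_complex_ofReal]; congr 1; ext t; push_cast; rfl
  rw [this, hfr]; simp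

lemma fac_zero (z : Fin N) (k : ℤ) (f : Fin N → ℝ → ℝ) (q : Fin N) (hq : q ≠ z)
    (hfq : ∀ t, f q t = 1) (r : Fin N) (hfr : ∫ t, psi t * f r t = 0) : ∏ i, fac z k f i = 0 := by
  by_cases hk : k = 0
  · subst hk; exact fac_zero_of_mean z f r hfr
  · exact fac_zero_of_one z k hk f q hq hfq

/-- the one-dimensional trigonometric sum and its derivatives -/
def tv (M : ℕ) (A : ℕ → ℝ) (n : ℕ → ℕ) (t : ℝ) : ℝ := ∑ l ∈ Finset.range M, A l * Real.cos (n l * t)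
def tv1 (M : ℕ) (A : ℕ → ℝ) (n : ℕ → ℕ) (t : ℝ) : ℝ :=
  ∑ l ∈ Finset.range M, (-(A l * n l)) * Real.sin (n l * t)
def tv2 (M : ℕ) (A : ℕ → ℝ) (n : ℕ → ℕ) (t : ℝ) : ℝ :=
  ∑ l ∈ Finset.range M, (-(A l * n l ^ 2)) * Real.cos (n l * t)

variable (M : ℕ) (A : ℕ → ℝ) (n : ℕ → ℕ)

lemma tv_deriv (t : ℝ) : HasDerivAt (tv M A n) (tv1 M A n t) t := by
  unfold tv tv1
  apply HasDerivAt.fun_sum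
  intro l _
  have h : HasDerivAt (fun t : ℝ => (n l : ℝ) * t) (n l : ℝ) t := by
    simpa using (hasDerivAt_id t).const_mul (n l : ℝ)
  have := (h.cos).const_mul (A l)
  exact this.congr_deriv (by ring)

lemma tv1_deriv (t : ℝ) : HasDerivAt (tv1 M A n) (tv2 M A n t) t := by
  unfold tv1 tv2
  apply HasDerivAt.fun_sum
  intro l _
  have h : HasDerivAt (fun t : ℝ => (n l : ℝ) * t) (n l : ℝ) t := by
    simpa using (hasDerivAt_id t).const_mul (n l : ℝ)
  have := (h.sin).const_mul (-(A l * n l))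
  exact this.congr_deriv (by ring)

lemma tv_contDiff : ContDiff ℝ (⊤ : ℕ∞) (tv M A n) := by
  unfold tv
  fun_prop

lemma tv1_continuous : Continuous (tv1 M A n) := by unfold tv1; fun_prop
lemma tv2_continuous : Continuous (tv2 M A n) := by unfold tv2; fun_prop

/-- Fourier coefficient of `tv1` -/
lemma tv1_fourier (hn : ∀ l, 0 < n l) (hinj : Function.Injective n) (m : ℕ) (hm : m ∈ Finset.range M) :
    ∫ t : ℝ, (psi t : ℂ) * ((tv1 M A n t : ℂ) * Complex.exp (Complex.I * n m * t))
      = - (A m * n m * π) * Complex.I := by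
  have e : ∀ t : ℝ, (psi t : ℂ) * ((tv1 M A n t : ℂ) * Complex.exp (Complex.I * n m * t))
      = ∑ l ∈ Finset.range M, (-(A l * n l) : ℂ) *
        ((psi t : ℂ) * ((Real.sin (n l * t) : ℂ) * Complex.exp (Complex.I * n m * t))) := by
    intro t
    unfold tv1
    rw [Complex.ofReal_sum, Finset.sum_mul, Finset.mul_sum]
    apply Finset.sum_congr rfl
    intro l _
    push_cast; ring
  simp_rw [e]
  rw [integral_finsetSum]
  · simp_rw [integral_const_mul]
    rw [Finset.sum_eq_single m]
    · rw [psi_sin_exp _ _ (hn _) (hn _), if_pos rfl]; ring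
    · intro l _ hl
      rw [psi_sin_exp _ _ (hn _) (hn _), if_neg (fun h => hl (hinj h)), mul_zero]
    · intro h; exact absurd hm h
  · intro l _
    exact (psi_mul_integrable _ (by fun_prop)).const_mul _

lemma tv2_fourier (hn : ∀ l, 0 < n l) (hinj : Function.Injective n) (m : ℕ) (hm : m ∈ Finset.range M) :
    ∫ t : ℝ, (psi t : ℂ) * (((-tv2 M A n t : ℝ) : ℂ) * Complex.exp (Complex.I * n m * t))
      = (A m * n m ^ 2 * π : ℝ) := by
  have e : ∀ t : ℝ, (psi t : ℂ) * (((-tv2 M A n t : ℝ) : ℂ) * Complex.exp (Complex.I * n m * t))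
      = ∑ l ∈ Finset.range M, (A l * n l ^ 2 : ℂ) *
        ((psi t : ℂ) * ((Real.cos (n l * t) : ℂ) * Complex.exp (Complex.I * n m * t))) := by
    intro t
    unfold tv2
    rw [← Finset.sum_neg_distrib, Complex.ofReal_sum, Finset.sum_mul, Finset.mul_sum]
    apply Finset.sum_congr rfl
    intro l _
    push_cast; ring
  simp_rw [e]
  rw [integral_finsetSum]
  · simp_rw [integral_const_mul]
    rw [Finset.sum_eq_single m]
    · rw [psi_cos_exp _ _ (hn _), if_pos rfl]; push_cast; ring
    · intro l _ hl
      rw [psi_cos_exp _ _ (hn _), if_neg (fun h => hl (hinj h)), mul_zero]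
    · intro h; exact absurd hm h
  · intro l _
    exact (psi_mul_integrable _ (by fun_prop)).const_mul _

lemma tv2_mean (hn : ∀ l, 0 < n l) : ∫ t : ℝ, psi t * tv2 M A n t = 0 := by
  have e : ∀ t : ℝ, psi t * tv2 M A n t
      = ∑ l ∈ Finset.range M, (-(A l * n l ^ 2)) * (psi t * Real.cos (n l * t)) := by
    intro t
    unfold tv2
    rw [Finset.mul_sum]
    apply Finset.sum_congr rfl
    intro l _
    ring
  simp_rw [e]
  have hc : ∀ l, ∫ t : ℝ, psi t * Real.cos (n l * t) = 0 := by
    intro l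
    have := psi_cos_exp (n l) 0 (hn l)
    rw [if_neg (hn l).ne'] at this
    simp only [Nat.cast_zero, mul_zero, zero_mul, Complex.exp_zero, mul_one] at this
    have h2 : ∫ t, (psi t : ℂ) * (Real.cos (n l * t) : ℂ) = ((∫ t, psi t * Real.cos (n l * t) : ℝ) : ℂ) := by
      rw [← integral_complex_ofReal]; congr 1; ext t; push_cast; rfl
    rw [h2] at this
    exact_mod_cast this
  rw [integral_finsetSum]
  · simp_rw [integral_const_mul, hc]; simp
  · intro l _
    apply Integrable.const_mul
    apply Continuous.integrable_of_hasCompactSupport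
    · exact psi_continuous.mul (by fun_prop)
    · exact psi_hasCompactSupport.mul_right

lemma tv2_neg_mean (hn : ∀ l, 0 < n l) : ∫ t : ℝ, psi t * -tv2 M A n t = 0 := by
  simp_rw [mul_neg]
  rw [integral_neg, tv2_mean M A n hn, neg_zero]

end integ


section integ2
variable {N : ℕ}

/-- the basic integrals -/
def KK (z : Fin N) (g : ℝ → ℝ) (f : Fin N → ℝ → ℝ) : ℝ :=
  ∫ x : Eu N, g (TT z x) * ∏ i, (psi (x i) * f i (x i))

lemma KK_sum {ι : Type} (S : Finset ι) (z : Fin N) (g : ι → ℝ → ℝ) (hg : ∀ i, Continuous (g i))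
    (c : ι → ℝ) (f : Fin N → ℝ → ℝ) (hf : ∀ i, Continuous (f i)) :
    KK z (fun t => ∑ i ∈ S, c i * g i t) f = ∑ i ∈ S, c i * KK z (g i) f := by
  unfold KK
  simp_rw [Finset.sum_mul, mul_assoc]
  rw [integral_finsetSum]
  · simp_rw [integral_const_mul]
  · intro i _
    exact (K_integrable z (g i) (hg i) f hf).const_mul _

lemma KK_sinsin (z : Fin N) (m n : ℕ) (f : Fin N → ℝ → ℝ) (hf : ∀ i, Continuous (f i))
    (h : ∀ k, ∏ i, fac z k f i = 0) :
    KK z (fun t => Real.sin (m * t) * Real.sin (n * t)) f = 0 := by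
  have e : (fun t : ℝ => Real.sin (m * t) * Real.sin (n * t)) = fun t =>
      ∑ i ∈ (Finset.univ : Finset (Fin 2)), (![1/2, -1/2] i : ℝ) *
        Real.cos (((![(m:ℤ) - n, (m:ℤ) + n] i : ℤ) : ℝ) * t) := by
    funext t
    simp only [Fin.sum_univ_two, Matrix.cons_val_zero, Matrix.cons_val_one]
    push_cast
    rw [sub_mul, add_mul, Real.cos_sub, Real.cos_add]
    ring
  rw [e, KK_sum _ _ _ (fun i => by fun_prop) _ _ hf]
  apply Finset.sum_eq_zero
  intro i _
  unfold KK
  rw [K_cos z _ f hf, h]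
  simp

variable (M : ℕ) (A : ℕ → ℝ) (n : ℕ → ℕ)

lemma KK_tv1_sq (z : Fin N) (f : Fin N → ℝ → ℝ) (hf : ∀ i, Continuous (f i))
    (h : ∀ k, ∏ i, fac z k f i = 0) :
    KK z (fun t => tv1 M A n t ^ 2) f = 0 := by
  have e : (fun t : ℝ => tv1 M A n t ^ 2) = fun t =>
      ∑ i ∈ Finset.range M ×ˢ Finset.range M, (A i.1 * n i.1 * (A i.2 * n i.2)) *
        (Real.sin (n i.1 * t) * Real.sin (n i.2 * t)) := by
    funext t
    unfold tv1
    rw [sq, Finset.sum_mul_sum, Finset.sum_product]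
    apply Finset.sum_congr rfl
    intro i _
    apply Finset.sum_congr rfl
    intro j _
    ring
  rw [e, KK_sum _ _ _ (fun i => by fun_prop) _ _ hf]
  apply Finset.sum_eq_zero
  intro i _
  rw [KK_sinsin z _ _ f hf h, mul_zero]

lemma KK_tv2 (z : Fin N) (f : Fin N → ℝ → ℝ) (hf : ∀ i, Continuous (f i))
    (h : ∀ k : ℤ, k ≠ 0 → ∏ i, fac z k f i = 0) (hn : ∀ l, 0 < n l) :
    KK z (fun t => tv2 M A n t) f = 0 := by
  unfold tv2
  rw [KK_sum _ _ (fun l t => Real.cos (n l * t)) (fun i => by fun_prop) _ _ hf]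
  apply Finset.sum_eq_zero
  intro l _
  have := K_cos z (n l : ℤ) f hf
  rw [h _ (by exact_mod_cast (hn l).ne')] at this
  simp only [Int.cast_natCast, Complex.zero_re] at this
  unfold KK
  rw [this, mul_zero]

lemma KK_one (z : Fin N) (f : Fin N → ℝ → ℝ) (hf : ∀ i, Continuous (f i))
    (h : ∏ i, fac z 0 f i = 0) : KK z (fun _ => 1) f = 0 := by
  have := K_cos z 0 f hf
  rw [h] at this
  simpa [KK] using this

/-- factor families -/
def ff (z o : Fin N) (a b : ℝ → ℝ) (c : Fin N → ℝ → ℝ) : Fin N → ℝ → ℝ :=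
  fun i => if i = z then a else if i = o then b else c i

lemma ff_continuous (z o : Fin N) {a b : ℝ → ℝ} {c : Fin N → ℝ → ℝ} (ha : Continuous a)
    (hb : Continuous b) (hc : ∀ i, Continuous (c i)) (i : Fin N) : Continuous (ff z o a b c i) := by
  unfold ff
  split_ifs
  · exact ha
  · exact hb
  · exact hc i

lemma prod_split (z o : Fin N) (hzo : o ≠ z) {R : Type} [CommMonoid R] (g : Fin N → R) :
    ∏ i, g i = g z * (g o * ∏ i ∈ (Finset.univ.erase z).erase o, g i) := by
  rw [← Finset.mul_prod_erase _ g (Finset.mem_univ z), ← Finset.mul_prod_erase _ g (a := o)]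
  simp [hzo]

lemma prod_ff (z o : Fin N) (hzo : o ≠ z) (a b : ℝ → ℝ) (c : Fin N → ℝ → ℝ) (x : Eu N) :
    ∏ i, (psi (x i) * ff z o a b c i (x i)) = phi x * (a (x z) * (b (x o) *
      ∏ i ∈ (Finset.univ.erase z).erase o, c i (x i))) := by
  rw [prod_psi_eq, prod_split z o hzo]
  congr 2
  · simp [ff]
  · congr 1
    · simp [ff, hzo]
    · apply Finset.prod_congr rfl
      intro i hi
      simp only [Finset.mem_erase] at hi
      simp [ff, hi.1, hi.2.1]

def cj (j : Fin N) (w : ℝ → ℝ) : Fin N → ℝ → ℝ := fun i => if i = j then (fun _ => 1) else w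

lemma cj_continuous (j : Fin N) {w : ℝ → ℝ} (hw : Continuous w) (i : Fin N) :
    Continuous (cj j w i) := by
  unfold cj
  split_ifs
  · exact continuous_const
  · exact hw

lemma prod_cj (j : Fin N) (w : ℝ → ℝ) (x : Eu N) (S : Finset (Fin N)) (hj : j ∈ S) :
    ∏ i ∈ S, cj j w i (x i) = ∏ i ∈ S.erase j, w (x i) := by
  rw [← Finset.mul_prod_erase S _ hj]
  simp only [cj, if_true, one_mul]
  apply Finset.prod_congr rfl
  intro i hi
  simp only [Finset.mem_erase] at hi
  simp [hi.1]

/-- main term -/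
lemma KK_main (z o : Fin N) (hzo : o ≠ z) (hn : ∀ l, 0 < n l) (hinj : Function.Injective n) :
    KK z (tv1 M A n) (ff z o (fun _ => 1) (tv1 M A n) (fun _ t => -tv2 M A n t))
      = ∑ l ∈ Finset.range M, (A l * n l) * ((A l * n l * π) * (A l * n l ^ 2 * π) ^ (N - 2) * (2 * π)) := by
  have hf := ff_continuous z o (a := fun _ => 1) (b := tv1 M A n) (c := fun _ t => -tv2 M A n t)
    continuous_const (tv1_continuous M A n) (fun _ => (tv2_continuous M A n).neg)
  have : KK z (tv1 M A n) (ff z o (fun _ => 1) (tv1 M A n) (fun _ t => -tv2 M A n t))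
    = ∑ l ∈ Finset.range M, (-(A l * n l)) * KK z (fun t => Real.sin (n l * t))
      (ff z o (fun _ => 1) (tv1 M A n) (fun _ t => -tv2 M A n t)) := by
    rw [← KK_sum _ _ (fun l t => Real.sin (n l * t)) (fun i => by fun_prop) _ _ hf]
    rfl
  rw [this]
  apply Finset.sum_congr rfl
  intro l hl
  have h2 := K_sin z (n l : ℤ) _ hf
  simp only [Int.cast_natCast] at h2
  unfold KK
  rw [h2, prod_split z o hzo]
  have e1 : fac z (n l : ℤ) (ff z o (fun _ => 1) (tv1 M A n) (fun _ t => -tv2 M A n t)) z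
      = ((2 * π : ℝ) : ℂ) := by
    have := psi_exp 0
    simp only [Int.cast_zero, mul_zero, zero_mul, Complex.exp_zero, mul_one, if_true] at this
    simp [fac, ff, this]
  have e2 : fac z (n l : ℤ) (ff z o (fun _ => 1) (tv1 M A n) (fun _ t => -tv2 M A n t)) o
      = - (A l * n l * π) * Complex.I := by
    rw [← tv1_fourier M A n hn hinj l hl]
    simp [fac, ff, hzo]
  have e3 : ∀ i ∈ (Finset.univ.erase z).erase o,
      fac z (n l : ℤ) (ff z o (fun _ => 1) (tv1 M A n) (fun _ t => -tv2 M A n t)) i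
      = ((A l * n l ^ 2 * π : ℝ) : ℂ) := by
    intro i hi
    simp only [Finset.mem_erase] at hi
    rw [← tv2_fourier M A n hn hinj l hl]
    simp [fac, ff, hi.1, hi.2.1]
  rw [e1, e2, Finset.prod_congr rfl e3, Finset.prod_const]
  have hcard : ((Finset.univ.erase z).erase o).card = N - 2 := by
    rw [Finset.card_erase_of_mem (by simp [hzo]), Finset.card_erase_of_mem (by simp)]
    simp; omega
  rw [hcard]
  have : (((2 * π : ℝ) : ℂ) * (-(A l * n l * π) * Complex.I * ((A l * n l ^ 2 * π : ℝ) : ℂ) ^ (N - 2)))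
     = ((-((A l * n l * π) * (A l * n l ^ 2 * π) ^ (N - 2) * (2 * π)) : ℝ) : ℂ) * Complex.I := by
    push_cast; ring
  rw [this, Complex.im_ofReal_mul, Complex.I_im]
  ring

theorem integral_hessDet_UU (z o : Fin N) (hzo : o ≠ z) (hN : 3 ≤ N) (hn : ∀ l, 0 < n l)
    (hinj : Function.Injective n) :
    ∫ x : Eu N, hessDet (UU z o (tv M A n)) x * phi x
      = 2 * ∑ l ∈ Finset.range M,
        (A l * n l) * ((A l * n l * π) * (A l * n l ^ 2 * π) ^ (N - 2) * (2 * π)) := by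
  set J := ((Finset.univ.erase z).erase o : Finset (Fin N)) with hJ
  set v1 := tv1 M A n with hv1
  set v2 := tv2 M A n with hv2
  have c1 : Continuous v1 := tv1_continuous M A n
  have c2 : Continuous v2 := tv2_continuous M A n
  have hcard : J.card = N - 2 := by
    rw [hJ, Finset.card_erase_of_mem (by simp [hzo]), Finset.card_erase_of_mem (by simp)]
    simp; omega
  obtain ⟨r, hr⟩ : J.Nonempty := by rw [← Finset.card_pos]; omega
  have hJm : ∀ j ∈ J, j ≠ o ∧ j ≠ z := by
    intro j hj
    simpa [hJ] using hj
  set w : ℝ → ℝ := fun t => -v2 t with hw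
  have cw : Continuous w := c2.neg
  set fa := ff z o (fun _ => 1) v1 (fun _ => w)
  set fb := ff z o (fun _ => 1) (fun t => v1 t ^ 2) (fun _ => w)
  set fc := ff z o (fun _ => 1) (fun _ => 1) (fun _ => w)
  set fd := fun j => ff z o (fun t => t) v2 (cj j w)
  set fe := fun j => ff z o (fun t => t) (fun t => v1 t ^ 2) (cj j w)
  have ha : ∀ i, Continuous (fa i) := ff_continuous z o continuous_const c1 (fun _ => cw)
  have hb : ∀ i, Continuous (fb i) := ff_continuous z o continuous_const (c1.pow 2) (fun _ => cw)
  have hc : ∀ i, Continuous (fc i) := ff_continuous z o continuous_const continuous_const (fun _ => cw)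
  have hd : ∀ j i, Continuous (fd j i) := fun j =>
    ff_continuous z o continuous_id c2 (cj_continuous j cw)
  have he : ∀ j i, Continuous (fe j i) := fun j =>
    ff_continuous z o continuous_id (c1.pow 2) (cj_continuous j cw)
  have hwm : ∫ t, psi t * w t = 0 := tv2_neg_mean M A n hn
  have hv2m : ∫ t, psi t * v2 t = 0 := tv2_mean M A n hn
  have ia := K_integrable z v1 c1 fa ha
  have ib := K_integrable z (fun _ => 1) continuous_const fb hb
  have ic := K_integrable z (fun t => v1 t ^ 2) (c1.pow 2) fc hc
  have id' := fun j => K_integrable z (fun t => v1 t ^ 2) (c1.pow 2) (fd j) (hd j)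
  have ie := fun j => K_integrable z v2 c2 (fe j) (he j)
  have e : ∀ x : Eu N, hessDet (UU z o (tv M A n)) x * phi x =
      2 * (v1 (TT z x) * ∏ i, (psi (x i) * fa i (x i)))
      - (1 * ∏ i, (psi (x i) * fb i (x i)))
      - (v1 (TT z x) ^ 2 * ∏ i, (psi (x i) * fc i (x i)))
      - ∑ j ∈ J, (v1 (TT z x) ^ 2 * ∏ i, (psi (x i) * fd j i (x i)))
      + ∑ j ∈ J, (v2 (TT z x) * ∏ i, (psi (x i) * fe j i (x i))) := by
    intro x
    rw [hessDet_UU (tv_deriv M A n) (tv1_deriv M A n) z o hzo x]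
    simp only [fa, fb, fc, fd, fe, prod_ff z o hzo]
    have s1 : ∀ j ∈ J, v1 (TT z x) ^ 2 * (phi x * (x z * (v2 (x o) * ∏ i ∈ J, cj j w i (x i))))
        = v1 (TT z x) ^ 2 * phi x * (x z * v2 (x o) * ∏ i ∈ J.erase j, (-v2 (x i))) := by
      intro j hj
      rw [prod_cj j w x J hj]; ring
    have s2 : ∀ j ∈ J, v2 (TT z x) * (phi x * (x z * (v1 (x o) ^ 2 * ∏ i ∈ J, cj j w i (x i))))
        = v2 (TT z x) * phi x * (x z * v1 (x o) ^ 2) * (∏ i ∈ J.erase j, (-v2 (x i))) := by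
      intro j hj
      rw [prod_cj j w x J hj]; ring
    rw [Finset.sum_congr rfl s1, Finset.sum_congr rfl s2, ← Finset.mul_sum, ← Finset.mul_sum]
    simp only [hw]
    rw [← hv1, ← hv2, ← hJ]
    simp only [← Finset.mul_sum]
    generalize ∏ i ∈ J, -v2 (x i) = P1
    generalize ∑ j ∈ J, ∏ i ∈ J.erase j, -v2 (x i) = P3
    ring
  simp_rw [e]
  rw [integral_add, integral_sub, integral_sub, integral_sub, integral_const_mul,
    integral_finsetSum, integral_finsetSum]
  · have za : ∫ x : Eu N, v1 (TT z x) * ∏ i, (psi (x i) * fa i (x i)) = _ :=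
      KK_main M A n z o hzo hn hinj
    have zb : ∫ x : Eu N, 1 * ∏ i, (psi (x i) * fb i (x i)) = 0 := by
      apply KK_one z fb hb
      apply fac_zero_of_mean z fb r
      simpa [fb, ff, (hJm r hr).1, (hJm r hr).2] using hwm
    have zc : ∫ x : Eu N, v1 (TT z x) ^ 2 * ∏ i, (psi (x i) * fc i (x i)) = 0 := by
      apply KK_tv1_sq M A n z fc hc
      intro k
      apply fac_zero z k fc o hzo _ r
      · simpa [fc, ff, (hJm r hr).1, (hJm r hr).2] using hwm
      · simp [fc, ff, hzo]
    have zd : ∀ j ∈ J, ∫ x : Eu N, v1 (TT z x) ^ 2 * ∏ i, (psi (x i) * fd j i (x i)) = 0 := by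
      intro j hj
      apply KK_tv1_sq M A n z (fd j) (hd j)
      intro k
      apply fac_zero z k (fd j) j (hJm j hj).2 _ o
      · simpa [fd, ff, hzo] using hv2m
      · simp [fd, ff, (hJm j hj).1, (hJm j hj).2, cj]
    have ze : ∀ j ∈ J, ∫ x : Eu N, v2 (TT z x) * ∏ i, (psi (x i) * fe j i (x i)) = 0 := by
      intro j hj
      apply KK_tv2 M A n z (fe j) (he j) _ hn
      intro k hk
      apply fac_zero_of_one z k hk (fe j) j (hJm j hj).2
      simp [fe, ff, (hJm j hj).1, (hJm j hj).2, cj]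
    rw [za, zb, zc, Finset.sum_eq_zero zd, Finset.sum_eq_zero ze]
    ring
  · intro j _; exact ie j
  · intro j _; exact id' j
  · exact ia.const_mul 2
  · exact ib
  · exact (ia.const_mul 2).sub ib
  · exact ic
  · exact ((ia.const_mul 2).sub ib).sub ic
  · exact integrable_finsetSum _ fun j _ => id' j
  · exact (((ia.const_mul 2).sub ib).sub ic).sub (integrable_finsetSum _ fun j _ => id' j)
  · exact integrable_finsetSum _ fun j _ => ie j

end integ2


section hold

lemma geom_sum_bd {b β : ℝ} (hb0 : 0 ≤ b) (hb : b ≤ β) (hβ : β < 1) (M : ℕ) :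
    ∑ l ∈ Finset.range M, b ^ l ≤ 1 / (1 - β) := by
  have h1 : ∑ l ∈ Finset.range M, b ^ l ≤ ∑' l, b ^ l :=
    (summable_geometric_of_lt_one hb0 (by linarith)).sum_le_tsum _ (fun i _ => by positivity)
  rw [tsum_geometric_of_lt_one hb0 (by linarith)] at h1
  refine h1.trans ?_
  rw [← one_div]
  apply one_div_le_one_div_of_le <;> linarith

lemma holder_sum {δ τ : ℝ} (hδ : 0 < δ) (h1 : δ ≤ τ) (h2 : τ ≤ 1 - δ) (M : ℕ) :
    ∀ r : ℝ, 0 ≤ r → r ≤ 1 → 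
    ∑ l ∈ Finset.range M, ((2:ℝ) ^ (-τ)) ^ l * min 1 (2 ^ l * r)
      ≤ 2 * (1 + 1 / (1 - (2:ℝ) ^ (-δ)) + 1 / ((2:ℝ) ^ δ - 1)) * r ^ τ - (1 / ((2:ℝ) ^ δ - 1)) * r := by
  set b := (2:ℝ) ^ (-τ) with hb
  set C1 := 1 / (1 - (2:ℝ) ^ (-δ)) with hC1
  set D := 1 / ((2:ℝ) ^ δ - 1) with hD
  have hb0 : 0 < b := by positivity
  have hβ : (2:ℝ) ^ (-δ) < 1 := by
    apply Real.rpow_lt_one_of_one_lt_of_neg <;> linarith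
  have hbβ : b ≤ (2:ℝ) ^ (-δ) := Real.rpow_le_rpow_of_exponent_le (by norm_num) (by linarith)
  have hC10 : 0 < C1 := by rw [hC1]; apply one_div_pos.2; linarith
  have h2δ : 1 < (2:ℝ) ^ δ := Real.one_lt_rpow (by norm_num) hδ
  have hD0 : 0 < D := by rw [hD]; apply one_div_pos.2; linarith
  have hDe : D * ((2:ℝ) ^ δ - 1) = 1 := by rw [hD]; field_simp [sub_ne_zero.2 h2δ.ne']
  have hbb : b * (2:ℝ) ^ τ = 1 := by
    rw [hb, ← Real.rpow_add (by norm_num)]; simp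
  have h2b : (2:ℝ) ^ δ ≤ 2 * b := by
    have : 2 * b = (2:ℝ) ^ (1 - τ) := by
      rw [hb, sub_eq_add_neg, Real.rpow_add (by norm_num), Real.rpow_one]
    rw [this]
    exact Real.rpow_le_rpow_of_exponent_le (by norm_num) (by linarith)
  have hpow : ∀ r : ℝ, 0 ≤ r → r ≤ 1 → r ≤ r ^ τ := by
    intro r hr hr1
    rcases eq_or_lt_of_le hr with h | h
    · rw [← h, Real.zero_rpow (by linarith)]
    · calc r = r ^ (1:ℝ) := (Real.rpow_one r).symm
        _ ≤ r ^ τ := Real.rpow_le_rpow_of_exponent_ge h hr1 (by linarith)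
  induction M with
  | zero =>
    intro r hr hr1
    simp only [Finset.range_zero, Finset.sum_empty]
    have := hpow r hr hr1
    nlinarith [mul_nonneg hC10.le (hr.trans this), mul_nonneg hD0.le (hr.trans this),
      mul_le_mul_of_nonneg_left this hD0.le]
  | succ M ih =>
    intro r hr hr1
    rw [Finset.sum_range_succ']
    have e : ∑ k ∈ Finset.range M, b ^ (k + 1) * min 1 (2 ^ (k + 1) * r)
        = b * ∑ k ∈ Finset.range M, b ^ k * min 1 (2 ^ k * (2 * r)) := by
      rw [Finset.mul_sum]
      apply Finset.sum_congr rfl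
      intro k _
      rw [show (2:ℝ) ^ (k+1) * r = 2 ^ k * (2 * r) by ring]
      ring
    rw [e]
    simp only [pow_zero, one_mul]
    rw [min_eq_right hr1]
    have hr' := hpow r hr hr1
    by_cases hc : 2 * r ≤ 1
    · have := ih (2 * r) (by linarith) hc
      rw [Real.mul_rpow (by norm_num) hr] at this
      have h3 := mul_le_mul_of_nonneg_left this hb0.le
      have e3 : b * (2 * (1 + C1 + D) * (2 ^ τ * r ^ τ) - D * (2 * r))
          = 2 * (1 + C1 + D) * r ^ τ * (b * 2 ^ τ) - D * r * (2 * b) := by ring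
      rw [e3, hbb] at h3
      have h4 : D * r * (2:ℝ) ^ δ ≤ D * r * (2 * b) := mul_le_mul_of_nonneg_left h2b (by positivity)
      have h5 : D * r * (2:ℝ) ^ δ = r + D * r := by linear_combination r * hDe
      linarith
    · push Not at hc
      have h6 : ∑ k ∈ Finset.range M, b ^ k * min 1 (2 ^ k * (2 * r)) ≤ C1 := by
        refine le_trans (Finset.sum_le_sum fun k _ => ?_) (geom_sum_bd hb0.le hbβ hβ M)
        calc b ^ k * min 1 (2 ^ k * (2 * r)) ≤ b ^ k * 1 := by
              gcongr; exact min_le_left _ _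
          _ = b ^ k := mul_one _
      have h7 : b * ∑ k ∈ Finset.range M, b ^ k * min 1 (2 ^ k * (2 * r)) ≤ C1 := by
        have hs : 0 ≤ ∑ k ∈ Finset.range M, b ^ k * min 1 (2 ^ k * (2 * r)) :=
          Finset.sum_nonneg fun k _ => by positivity
        nlinarith
      have h8 : (1/2 : ℝ) ≤ r ^ τ := by linarith
      nlinarith [mul_le_mul_of_nonneg_left h8 (by positivity : 0 ≤ 2 * (1 + C1 + D)),
        mul_le_mul_of_nonneg_left hr1 hD0.le]

/-- amplitude ratio -/
def aN (N : ℕ) : ℝ := (2:ℝ) ^ (-(1 - 2 / (N:ℝ)))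
/-- amplitudes -/
def AA (N : ℕ) (ε : ℝ) (l : ℕ) : ℝ := ε * (aN N / 2) ^ l
/-- frequencies -/
def nn (l : ℕ) : ℕ := 2 ^ l

lemma aN_pos (N : ℕ) : 0 < aN N := by unfold aN; positivity

lemma AA_nn (N : ℕ) (ε : ℝ) (l : ℕ) : AA N ε l * nn l = ε * aN N ^ l := by
  unfold AA nn
  push_cast
  rw [div_pow]
  field_simp

lemma sin_diff_le (x y : ℝ) : |Real.sin x - Real.sin y| ≤ 2 * min 1 |x - y| := by
  have h1 : |Real.sin x - Real.sin y| ≤ |x - y| := by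
    have := Real.lipschitzWith_sin.dist_le_mul x y
    simpa [Real.dist_eq] using this
  have h2 : |Real.sin x - Real.sin y| ≤ 2 := by
    have := abs_sub (Real.sin x) (Real.sin y)
    linarith [Real.abs_sin_le_one x, Real.abs_sin_le_one y]
  rcases le_total 1 |x - y| with h | h
  · rw [min_eq_left h]; linarith
  · rw [min_eq_right h]; linarith [abs_nonneg (x - y)]

lemma tv_bounds (N : ℕ) (hN : 3 ≤ N) : ∃ C : ℝ, 0 < C ∧ ∀ M : ℕ, N ≤ M → ∀ ε : ℝ, 0 ≤ ε →
    (∀ t, |tv M (AA N ε) nn t| ≤ C * ε) ∧ (∀ t, |tv1 M (AA N ε) nn t| ≤ C * ε) ∧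
    (∀ t s, |tv1 M (AA N ε) nn t - tv1 M (AA N ε) nn s|
      ≤ C * ε * |t - s| ^ ((1 - 2 / (N:ℝ)) + 1 / (M:ℝ))) := by
  have hN0 : (0:ℝ) < N := by positivity
  have hN3 : (3:ℝ) ≤ N := by exact_mod_cast hN
  set δ : ℝ := 1 / (N:ℝ) with hδ
  have hδ0 : 0 < δ := by positivity
  have hNδ : 2 / (N:ℝ) = 2 * δ := by rw [hδ]; ring
  have hδ3 : 3 * δ ≤ 1 := by rw [hδ]; field_simp; linarith
  set β := (2:ℝ) ^ (-δ) with hβd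
  have hβ : β < 1 := by
    apply Real.rpow_lt_one_of_one_lt_of_neg <;> linarith
  have haβ : aN N ≤ β := by
    unfold aN
    rw [hNδ]
    exact Real.rpow_le_rpow_of_exponent_le (by norm_num) (by linarith)
  have ha := aN_pos N
  set C1 := 1 / (1 - β) with hC1
  have hC10 : 0 < C1 := by rw [hC1]; apply one_div_pos.2; linarith
  have h2δ : 1 < (2:ℝ) ^ δ := Real.one_lt_rpow (by norm_num) hδ0
  set D := 1 / ((2:ℝ) ^ δ - 1) with hD
  have hD0 : 0 < D := by rw [hD]; apply one_div_pos.2; linarith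
  refine ⟨8 * (1 + C1 + D), by positivity, ?_⟩
  intro M hM ε hε
  have hM0 : (0:ℝ) < M := by
    have : 0 < M := by omega
    exact_mod_cast this
  have hMN : (N:ℝ) ≤ M := by exact_mod_cast hM
  set τ := (1 - 2 / (N:ℝ)) + 1 / (M:ℝ) with hτ
  have hMδ : 1 / (M:ℝ) ≤ δ := one_div_le_one_div_of_le hN0 hMN
  have hM1 : 0 < 1 / (M:ℝ) := by positivity
  have hv : ∀ t, |tv M (AA N ε) nn t| ≤ C1 * ε := by
    intro t
    unfold tv
    calc |∑ l ∈ Finset.range M, AA N ε l * Real.cos (nn l * t)|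
        ≤ ∑ l ∈ Finset.range M, |AA N ε l * Real.cos (nn l * t)| := Finset.abs_sum_le_sum_abs _ _
      _ ≤ ∑ l ∈ Finset.range M, ε * (aN N / 2) ^ l := by
          apply Finset.sum_le_sum
          intro l _
          rw [abs_mul]
          have : |AA N ε l| = ε * (aN N / 2) ^ l := abs_of_nonneg (by unfold AA; positivity)
          rw [this]
          have := Real.abs_cos_le_one (nn l * t)
          have h0 : 0 ≤ ε * (aN N / 2) ^ l := by positivity
          nlinarith
      _ = ε * ∑ l ∈ Finset.range M, (aN N / 2) ^ l := by rw [Finset.mul_sum]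
      _ ≤ ε * C1 := by
          gcongr
          exact geom_sum_bd (by positivity) (by linarith) hβ M
      _ = C1 * ε := mul_comm _ _
  have hv1 : ∀ t, |tv1 M (AA N ε) nn t| ≤ C1 * ε := by
    intro t
    unfold tv1
    calc |∑ l ∈ Finset.range M, (-(AA N ε l * nn l)) * Real.sin (nn l * t)|
        ≤ ∑ l ∈ Finset.range M, |(-(AA N ε l * nn l)) * Real.sin (nn l * t)| :=
          Finset.abs_sum_le_sum_abs _ _
      _ ≤ ∑ l ∈ Finset.range M, ε * (aN N) ^ l := by
          apply Finset.sum_le_sum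
          intro l _
          have h0 : 0 ≤ ε * (aN N) ^ l := by positivity
          rw [abs_mul, abs_neg, AA_nn, abs_of_nonneg h0]
          have := Real.abs_sin_le_one (nn l * t)
          nlinarith
      _ = ε * ∑ l ∈ Finset.range M, (aN N) ^ l := by rw [Finset.mul_sum]
      _ ≤ ε * C1 := by
          gcongr
          exact geom_sum_bd (by positivity) (by linarith) hβ M
      _ = C1 * ε := mul_comm _ _
  refine ⟨fun t => (hv t).trans ?_, fun t => (hv1 t).trans ?_, ?_⟩
  · gcongr; linarith
  · gcongr; linarith
  intro t s
  set r := |t - s| with hr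
  have hr0 : 0 ≤ r := abs_nonneg _
  by_cases hr1 : r ≤ 1
  · have key := holder_sum hδ0 (show δ ≤ τ by rw [hτ, hNδ]; linarith)
      (show τ ≤ 1 - δ by rw [hτ, hNδ]; linarith) M r hr0 hr1
    have hab : ∀ l ∈ Finset.range M, aN N ^ l ≤ 2 * ((2:ℝ) ^ (-τ)) ^ l := by
      intro l hl
      have hl' : (l:ℝ) ≤ M := by exact_mod_cast (Finset.mem_range.1 hl).le
      have : aN N = (2:ℝ) ^ (1 / (M:ℝ)) * (2:ℝ) ^ (-τ) := by
        rw [← Real.rpow_add (by norm_num)]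
        unfold aN
        congr 1
        rw [hτ]; ring
      rw [this, mul_pow]
      gcongr
      rw [← Real.rpow_natCast, ← Real.rpow_mul (by norm_num)]
      calc (2:ℝ) ^ (1 / (M:ℝ) * l) ≤ (2:ℝ) ^ (1:ℝ) := by
            apply Real.rpow_le_rpow_of_exponent_le (by norm_num)
            rw [one_div, inv_mul_le_iff₀ hM0]; linarith
        _ = 2 := Real.rpow_one 2
    unfold tv1
    rw [← Finset.sum_sub_distrib]
    calc |∑ l ∈ Finset.range M, (-(AA N ε l * nn l) * Real.sin (nn l * t)
            - -(AA N ε l * nn l) * Real.sin (nn l * s))|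
        ≤ ∑ l ∈ Finset.range M, |(-(AA N ε l * nn l) * Real.sin (nn l * t)
            - -(AA N ε l * nn l) * Real.sin (nn l * s))| :=
          Finset.abs_sum_le_sum_abs _ _
      _ ≤ ∑ l ∈ Finset.range M, 4 * ε * (((2:ℝ) ^ (-τ)) ^ l * min 1 (2 ^ l * r)) := by
          apply Finset.sum_le_sum
          intro l hl
          have h0 : 0 ≤ ε * (aN N) ^ l := by positivity
          rw [← mul_sub, abs_mul, abs_neg, AA_nn, abs_of_nonneg h0]
          have h1 := sin_diff_le (nn l * t) (nn l * s)
          have h2 : |(nn l : ℝ) * t - nn l * s| = 2 ^ l * r := by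
            rw [← mul_sub, abs_mul, hr]
            congr 1
            unfold nn
            push_cast
            exact abs_of_nonneg (by positivity)
          rw [h2] at h1
          have h3 := hab l hl
          calc ε * aN N ^ l * |Real.sin (nn l * t) - Real.sin (nn l * s)|
              ≤ ε * (2 * ((2:ℝ) ^ (-τ)) ^ l) * (2 * min 1 (2 ^ l * r)) := by
                gcongr
            _ = _ := by ring
      _ = 4 * ε * ∑ l ∈ Finset.range M, (((2:ℝ) ^ (-τ)) ^ l * min 1 (2 ^ l * r)) := by
          rw [Finset.mul_sum]
      _ ≤ 4 * ε * (2 * (1 + C1 + D) * r ^ τ) := by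
          gcongr
          refine key.trans ?_
          have : 0 ≤ D * r := by positivity
          linarith
      _ = _ := by ring
  · push Not at hr1
    have h1 : 1 ≤ r ^ τ := Real.one_le_rpow hr1.le (by rw [hτ, hNδ]; linarith)
    have h2 := abs_sub (tv1 M (AA N ε) nn t) (tv1 M (AA N ε) nn s)
    have h3 := hv1 t
    have h4 := hv1 s
    have h5 : 0 ≤ 8 * (1 + C1 + D) * ε := by positivity
    have h6 : C1 * ε + C1 * ε ≤ 8 * (1 + C1 + D) * ε := by
      nlinarith [mul_nonneg hD0.le hε, mul_nonneg hC10.le hε]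
    nlinarith

lemma nn_pos (l : ℕ) : 0 < nn l := by unfold nn; positivity
lemma nn_inj : Function.Injective nn := fun _ _ h => Nat.pow_right_injective (le_refl 2) h

/-- value of the amplitude sum -/
lemma amp_term (N : ℕ) (hN : 3 ≤ N) (ε : ℝ) (l : ℕ) :
    (AA N ε l * nn l) * ((AA N ε l * nn l * π) * (AA N ε l * nn l ^ 2 * π) ^ (N - 2) * (2 * π))
      = ε ^ N * (2 * π ^ N) := by
  have e2 : AA N ε l * (nn l : ℝ) ^ 2 = ε * (2 * aN N) ^ l := by
    rw [sq, ← mul_assoc, AA_nn]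
    unfold nn
    push_cast
    rw [mul_pow]; ring
  rw [e2, AA_nn]
  obtain ⟨m, rfl⟩ : ∃ m, N = m + 2 := ⟨N - 2, by omega⟩
  simp only [Nat.add_sub_cancel]
  have h : (2:ℝ) ^ m * aN (m + 2) ^ (m + 2) = 1 := by
    unfold aN
    rw [← Real.rpow_natCast, ← Real.rpow_natCast, ← Real.rpow_mul (by norm_num),
      ← Real.rpow_add (by norm_num)]
    have : (m:ℝ) + -(1 - 2 / ((m + 2 : ℕ):ℝ)) * ((m + 2 : ℕ):ℝ) = 0 := by
      have : ((m + 2 : ℕ):ℝ) ≠ 0 := by positivity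
      field_simp
      push_cast
      ring
    rw [this, Real.rpow_zero]
  have : ε * aN (m + 2) ^ l * (ε * aN (m + 2) ^ l * π * (ε * (2 * aN (m + 2)) ^ l * π) ^ m * (2 * π))
      = ε ^ (m + 2) * (2 * π ^ (m + 2)) * (2 ^ m * aN (m + 2) ^ (m + 2)) ^ l := by
    rw [mul_pow _ _ l, mul_pow _ _ m, mul_pow _ _ m, mul_pow _ _ m, mul_pow _ _ l]
    simp only [← pow_mul]
    ring
  rw [this, h, one_pow, mul_one]

end hold


section bes

/-- radial dominating kernel -/
def GG (N : ℕ) (a b r : ℝ) : ℝ := if r ≤ 1 then r ^ (-(N:ℝ) + a) else r ^ (-(N:ℝ) - b)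

lemma GG_nonneg (N : ℕ) (a b r : ℝ) (hr : 0 ≤ r) : 0 ≤ GG N a b r := by
  unfold GG; split_ifs <;> positivity

lemma GG_radial (N : ℕ) (hN : 1 ≤ N) (a b : ℝ) {y : ℝ} (hy : 0 < y) :
    y ^ (N - 1) • GG N a b y = if y ≤ 1 then y ^ (a - 1) else y ^ (-1 - b) := by
  rw [smul_eq_mul, ← Real.rpow_natCast, Nat.cast_sub hN]
  unfold GG
  split_ifs
  · rw [← Real.rpow_add hy]; congr 1; push_cast; ring
  · rw [← Real.rpow_add hy]; congr 1; push_cast; ring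

lemma GG_1d {a b : ℝ} (ha : 0 < a) (hb : 0 < b) :
    IntegrableOn (fun y : ℝ => if y ≤ 1 then y ^ (a - 1) else y ^ (-1 - b)) (Set.Ioi 0) ∧
    ∫ y in Set.Ioi (0:ℝ), (if y ≤ 1 then y ^ (a - 1) else y ^ (-1 - b)) = 1 / a + 1 / b := by
  have hU : Set.Ioi (0:ℝ) = Set.Ioc 0 1 ∪ Set.Ioi 1 := (Set.Ioc_union_Ioi_eq_Ioi zero_le_one).symm
  have e1 : Set.EqOn (fun y : ℝ => if y ≤ 1 then y ^ (a - 1) else y ^ (-1 - b))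
      (fun y => y ^ (a - 1)) (Set.Ioc 0 1) := fun y hy => by simp [hy.2]
  have e2 : Set.EqOn (fun y : ℝ => if y ≤ 1 then y ^ (a - 1) else y ^ (-1 - b))
      (fun y => y ^ (-1 - b)) (Set.Ioi 1) := fun y hy => by
    have : ¬ y ≤ 1 := not_le.2 hy
    simp [this]
  have i1 : IntegrableOn (fun y : ℝ => y ^ (a - 1)) (Set.Ioc 0 1) := by
    rw [← intervalIntegrable_iff_integrableOn_Ioc_of_le zero_le_one]
    exact intervalIntegral.intervalIntegrable_rpow' (by linarith)
  have i2 : IntegrableOn (fun y : ℝ => y ^ (-1 - b)) (Set.Ioi 1) :=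
    integrableOn_Ioi_rpow_of_lt (by linarith) one_pos
  have j1 := (integrableOn_congr_fun e1 measurableSet_Ioc).2 i1
  have j2 := (integrableOn_congr_fun e2 measurableSet_Ioi).2 i2
  rw [hU]
  refine ⟨j1.union j2, ?_⟩
  rw [setIntegral_union (Set.Ioc_disjoint_Ioi le_rfl) measurableSet_Ioi j1 j2,
    setIntegral_congr_fun measurableSet_Ioc e1, setIntegral_congr_fun measurableSet_Ioi e2,
    integral_Ioi_rpow_of_lt (by linarith) one_pos, ← intervalIntegral.integral_of_le zero_le_one,
    integral_rpow (Or.inl (by linarith))]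
  have : a ≠ 0 := ha.ne'
  have hb' : b ≠ 0 := hb.ne'
  rw [Real.one_rpow, Real.one_rpow, Real.zero_rpow (by simpa using this)]
  have h1 : a - 1 + 1 = a := by ring
  have h2 : -1 - b + 1 = -b := by ring
  rw [h1, h2]
  field_simp
  ring

lemma GG_int (N : ℕ) (hN : 1 ≤ N) {a b : ℝ} (ha : 0 < a) (hb : 0 < b) :
    Integrable (fun w : Eu N => GG N a b ‖w‖) ∧
    ∫ w : Eu N, GG N a b ‖w‖ = N * (volume.real (Metric.ball (0 : Eu N) 1) * (1 / a + 1 / b)) := by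
  haveI : Nonempty (Fin N) := ⟨⟨0, by omega⟩⟩
  haveI : Nontrivial (Eu N) := inferInstance
  have hfr : Module.finrank ℝ (Eu N) = N := by simp
  have hE : Set.EqOn (fun y : ℝ => y ^ (N - 1) • GG N a b y)
      (fun y => if y ≤ 1 then y ^ (a - 1) else y ^ (-1 - b)) (Set.Ioi 0) :=
    fun y hy => GG_radial N hN a b hy
  constructor
  · rw [integrable_fun_norm_addHaar volume, hfr]
    exact (integrableOn_congr_fun hE measurableSet_Ioi).2 (GG_1d ha hb).1
  · rw [integral_fun_norm_addHaar volume (GG N a b), hfr,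
      setIntegral_congr_fun measurableSet_Ioi hE, (GG_1d ha hb).2]
    simp [nsmul_eq_mul]

lemma besov_pointwise {N : ℕ} {p s R B τ : ℝ} {M : ℕ} (hp : 1 < p) (hτ : s - 1 + 1 / (M:ℝ) ≤ τ)
    (hτ0 : 0 < τ) (hB : 0 ≤ B) (g : Eu N → (Eu N →L[ℝ] ℝ)) (h0 : ∀ x, R < ‖x‖ → g x = 0)
    (h1 : ∀ x, ‖g x‖ ≤ B) (h2 : ∀ x y, ‖g x - g y‖ ≤ B * ‖x - y‖ ^ τ) (x y : Eu N) :
    ‖g x - g y‖ ^ p / ‖x - y‖ ^ ((N:ℝ) + (s-1)*p) ≤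
      (2 * B) ^ p * (((Metric.closedBall (0 : Eu N) R).indicator (fun _ => (1:ℝ)) x
        + (Metric.closedBall (0 : Eu N) R).indicator (fun _ => (1:ℝ)) y)
          * GG N (p / M) ((s-1)*p) ‖x - y‖) := by
  have hG := GG_nonneg N (p / M) ((s-1)*p) ‖x - y‖ (norm_nonneg _)
  have hix : ∀ z, 0 ≤ (Metric.closedBall (0 : Eu N) R).indicator (fun _ => (1:ℝ)) z := fun z =>
    Set.indicator_nonneg (fun _ _ => zero_le_one) z
  by_cases hxy : x ∉ Metric.closedBall (0 : Eu N) R ∧ y ∉ Metric.closedBall (0 : Eu N) R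
  · have hx : g x = 0 := h0 x (by simpa using hxy.1)
    have hy : g y = 0 := h0 y (by simpa using hxy.2)
    rw [hx, hy, sub_zero, norm_zero, Real.zero_rpow (by linarith), zero_div]
    exact mul_nonneg (by positivity) (mul_nonneg (add_nonneg (hix x) (hix y)) hG)
  · have hge : 1 ≤ (Metric.closedBall (0 : Eu N) R).indicator (fun _ => (1:ℝ)) x
        + (Metric.closedBall (0 : Eu N) R).indicator (fun _ => (1:ℝ)) y := by
      by_cases hx : x ∈ Metric.closedBall (0 : Eu N) R
      · rw [Set.indicator_of_mem hx]
        linarith [hix y]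
      · have hy : y ∈ Metric.closedBall (0 : Eu N) R := by
          by_contra hy; exact hxy ⟨hx, hy⟩
        rw [Set.indicator_of_mem hy]
        linarith [hix x]
    have key : ‖g x - g y‖ ^ p / ‖x - y‖ ^ ((N:ℝ) + (s-1)*p) ≤
        (2 * B) ^ p * GG N (p / M) ((s-1)*p) ‖x - y‖ := by
      rcases eq_or_lt_of_le (norm_nonneg (x - y)) with hr | hr
      · have : x = y := sub_eq_zero.1 (norm_eq_zero.1 hr.symm)
        subst this
        rw [sub_self, norm_zero, Real.zero_rpow (by linarith), zero_div]
        rw [sub_self, norm_zero] at hG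
        rw [sub_self, norm_zero]
        positivity
      · set r := ‖x - y‖ with hrd
        rw [div_eq_mul_inv, ← Real.rpow_neg hr.le]
        unfold GG
        split_ifs with h
        · calc ‖g x - g y‖ ^ p * r ^ (-((N:ℝ) + (s-1)*p))
              ≤ (B * r ^ τ) ^ p * r ^ (-((N:ℝ) + (s-1)*p)) := by
                gcongr; exact h2 x y
            _ = B ^ p * r ^ (τ * p + -((N:ℝ) + (s-1)*p)) := by
                rw [Real.mul_rpow hB (by positivity), ← Real.rpow_mul hr.le, Real.rpow_add hr]
                ring
            _ ≤ (2 * B) ^ p * r ^ (-(N:ℝ) + p / M) := by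
                apply mul_le_mul _ _ (by positivity) (by positivity)
                · apply Real.rpow_le_rpow hB (by linarith) (by linarith)
                · apply Real.rpow_le_rpow_of_exponent_ge hr h
                  have : p / M = (1 / (M:ℝ)) * p := by ring
                  rw [this]
                  nlinarith
        · have : -((N:ℝ) + (s-1)*p) = -(N:ℝ) - (s-1)*p := by ring
          rw [this]
          gcongr
          have := norm_sub_le (g x) (g y)
          linarith [h1 x, h1 y]
    refine key.trans ?_
    have : 0 ≤ (2 * B) ^ p := by positivity
    apply mul_le_mul_of_nonneg_left _ this
    nlinarith

open Convolution in
lemma besov_double {N : ℕ} (hN : 1 ≤ N) {p s R B τ : ℝ} {M : ℕ} (hp : 1 < p) (hs : 1 < s) (hM : 1 ≤ M)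
    (hτ : s - 1 + 1 / (M:ℝ) ≤ τ)
    (hτ0 : 0 < τ) (hB : 0 ≤ B) (g : Eu N → (Eu N →L[ℝ] ℝ)) (h0 : ∀ x, R < ‖x‖ → g x = 0)
    (h1 : ∀ x, ‖g x‖ ≤ B) (h2 : ∀ x y, ‖g x - g y‖ ≤ B * ‖x - y‖ ^ τ) :
    ∫ x : Eu N, ∫ y : Eu N, ‖g x - g y‖ ^ p / ‖x - y‖ ^ ((N:ℝ) + (s-1)*p) ≤
      (2 * B) ^ p * (2 * volume.real (Metric.closedBall (0 : Eu N) R) *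
        (N * (volume.real (Metric.ball (0 : Eu N) 1) * (1 / (p / M) + 1 / ((s-1)*p))))) := by
  have hM0 : (0:ℝ) < M := by exact_mod_cast hM
  have ha : 0 < p / M := by positivity
  have hb : 0 < (s-1)*p := mul_pos (by linarith) (by linarith)
  obtain ⟨iG, eG⟩ := GG_int N hN ha hb
  set G : Eu N → ℝ := fun w => GG N (p / M) ((s-1)*p) ‖w‖ with hG
  set K := Metric.closedBall (0 : Eu N) R with hK
  set χ : Eu N → ℝ := K.indicator (fun _ => (1:ℝ)) with hχ
  have hKm : MeasurableSet K := Metric.isClosed_closedBall.measurableSet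
  have iχ : Integrable χ := by
    rw [hχ, integrable_indicator_iff hKm]
    exact integrableOn_const (hs := (isCompact_closedBall _ _).measure_lt_top.ne)
  have eχ : ∫ x, χ x = volume.real K := by
    rw [hχ, integral_indicator hKm]; simp
  set c := (2 * B) ^ p with hc
  have hc0 : 0 ≤ c := by positivity
  have iGx : ∀ x, Integrable (fun y => G (x - y)) := fun x => iG.comp_sub_left x
  have bG : ∀ x, 0 ≤ G x := fun x => GG_nonneg _ _ _ _ (norm_nonneg _)
  have mulx : ∀ x, Integrable (fun y => χ y * G (x - y)) := by
    intro x
    refine (iGx x).mono ((iχ.aestronglyMeasurable).mul (iGx x).aestronglyMeasurable) ?_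
    refine ae_of_all _ fun y => ?_
    rw [norm_mul]
    have : ‖χ y‖ ≤ 1 := by
      rw [hχ]
      refine (norm_indicator_le_norm_self _ _).trans ?_
      simp
    exact mul_le_of_le_one_left (norm_nonneg _) this
  have inner : ∀ x, ∫ y : Eu N, ‖g x - g y‖ ^ p / ‖x - y‖ ^ ((N:ℝ) + (s-1)*p) ≤
      c * (χ x * ∫ w, G w) + c * (χ ⋆[ContinuousLinearMap.mul ℝ ℝ, volume] G) x := by
    intro x
    have hle : ∫ y : Eu N, ‖g x - g y‖ ^ p / ‖x - y‖ ^ ((N:ℝ) + (s-1)*p) ≤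
        ∫ y : Eu N, (c * (χ x * G (x - y)) + c * (χ y * G (x - y))) := by
      apply integral_mono_of_nonneg
      · exact ae_of_all _ fun y => by positivity
      · exact (((iGx x).const_mul _).const_mul _).add ((mulx x).const_mul _)
      · refine ae_of_all _ fun y => ?_
        have := besov_pointwise hp hτ hτ0 hB g h0 h1 h2 x y
        refine this.trans (le_of_eq ?_)
        simp only [hc, hχ, hG, hK]
        ring
    refine hle.trans (le_of_eq ?_)
    rw [integral_add (((iGx x).const_mul _).const_mul _) ((mulx x).const_mul _),
      integral_const_mul, integral_const_mul, integral_const_mul, integral_sub_left_eq_self G volume x]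
    rfl
  have iconv : Integrable (χ ⋆[ContinuousLinearMap.mul ℝ ℝ, volume] G) :=
    iχ.integrable_convolution _ iG
  have outer : ∫ x : Eu N, ∫ y : Eu N, ‖g x - g y‖ ^ p / ‖x - y‖ ^ ((N:ℝ) + (s-1)*p) ≤
      ∫ x : Eu N, (c * (χ x * ∫ w, G w) + c * (χ ⋆[ContinuousLinearMap.mul ℝ ℝ, volume] G) x) := by
    apply integral_mono_of_nonneg
    · exact ae_of_all _ fun x => integral_nonneg fun y => by positivity
    · exact ((iχ.mul_const _).const_mul _).add (iconv.const_mul _)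
    · exact ae_of_all _ inner
  refine outer.trans (le_of_eq ?_)
  rw [integral_add ((iχ.mul_const _).const_mul _) (iconv.const_mul _), integral_const_mul,
    integral_mul_const, integral_const_mul, integral_convolution _ iχ iG, eχ, eG]
  simp only [ContinuousLinearMap.mul_apply']
  ring

lemma besov_single {N : ℕ} {p R B : ℝ} (hp : 1 < p) (hB : 0 ≤ B) (g : Eu N → ℝ)
    (hg : ∀ x, 0 ≤ g x) (h0 : ∀ x, R < ‖x‖ → g x = 0) (h1 : ∀ x, g x ≤ B) :
    ∫ x : Eu N, g x ^ p ≤ B ^ p * volume.real (Metric.closedBall (0 : Eu N) R) := by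
  set K := Metric.closedBall (0 : Eu N) R with hK
  have hKm : MeasurableSet K := Metric.isClosed_closedBall.measurableSet
  have : ∫ x : Eu N, g x ^ p ≤ ∫ x : Eu N, K.indicator (fun _ => B ^ p) x := by
    apply integral_mono_of_nonneg
    · exact ae_of_all _ fun x => by have := hg x; positivity
    · rw [integrable_indicator_iff hKm]
      exact integrableOn_const (hs := (isCompact_closedBall _ _).measure_lt_top.ne)
    · refine ae_of_all _ fun x => ?_
      by_cases hx : x ∈ K
      · simp only [Set.indicator_of_mem hx]
        exact Real.rpow_le_rpow (hg x) (h1 x) (by linarith)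
      · simp only [Set.indicator_of_notMem hx]
        rw [h0 x (by simpa [hK] using hx), Real.zero_rpow (by linarith)]
  refine this.trans (le_of_eq ?_)
  rw [integral_indicator hKm]
  simp [mul_comm]

theorem besov_le (N : ℕ) (hN : 1 ≤ N) (p s R : ℝ) (hp : 1 < p) (hs : 1 < s) :
    ∃ C : ℝ, 0 ≤ C ∧ ∀ M : ℕ, 1 ≤ M → ∀ τ B : ℝ, s - 1 + 1 / (M:ℝ) ≤ τ → 0 ≤ B →
      ∀ u : Eu N → ℝ, (∀ x, R < ‖x‖ → u x = 0) → (∀ x, R < ‖x‖ → fderiv ℝ u x = 0) →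
      (∀ x, |u x| ≤ B) → (∀ x, ‖fderiv ℝ u x‖ ≤ B) →
      (∀ x y, ‖fderiv ℝ u x - fderiv ℝ u y‖ ≤ B * ‖x - y‖ ^ τ) →
      besov N s p u ≤ C * B * (1 + (M:ℝ)) ^ (1/p) := by
  set V := volume.real (Metric.closedBall (0 : Eu N) R) with hV
  set W := volume.real (Metric.ball (0 : Eu N) 1) with hW
  have hV0 : 0 ≤ V := measureReal_nonneg
  have hW0 : 0 ≤ W := measureReal_nonneg
  set c := 1 / p + 1 / ((s-1)*p) with hc
  have hc1 : 0 < 1 / ((s-1)*p) := by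
    apply one_div_pos.2; exact mul_pos (by linarith) (by linarith)
  have hc2 : 0 < 1 / p := by apply one_div_pos.2; linarith
  have hp0 : 0 < p := by linarith
  refine ⟨2 * V ^ (1/p) + 2 * (2 * V * (N * (W * c))) ^ (1/p), by positivity, ?_⟩
  intro M hM τ B hτ hB u hu0 hd0 hu hd hh
  have hM0 : (0:ℝ) < M := by exact_mod_cast hM
  have hM1 : 0 < 1 / (M:ℝ) := by positivity
  have root : ∀ (X Y : ℝ), 0 ≤ X → 0 ≤ Y → (X ^ p * Y) ^ (1/p) = X * Y ^ (1/p) := by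
    intro X Y hX hY
    rw [Real.mul_rpow (by positivity) hY, ← Real.rpow_mul hX, mul_one_div_cancel hp0.ne', Real.rpow_one]
  have t1 : (∫ x : Eu N, |u x| ^ p) ^ (1/p) ≤ B * V ^ (1/p) := by
    rw [← root B V hB hV0]
    apply Real.rpow_le_rpow _ _ hc2.le
    · exact integral_nonneg fun x => by positivity
    · exact besov_single hp hB (fun x => |u x|) (fun x => abs_nonneg _)
        (fun x hx => by simp [hu0 x hx]) hu
  have t2 : (∫ x : Eu N, ‖fderiv ℝ u x‖ ^ p) ^ (1/p) ≤ B * V ^ (1/p) := by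
    rw [← root B V hB hV0]
    apply Real.rpow_le_rpow _ _ hc2.le
    · exact integral_nonneg fun x => by positivity
    · exact besov_single hp hB (fun x => ‖fderiv ℝ u x‖) (fun x => norm_nonneg _)
        (fun x hx => by simp [hd0 x hx]) hd
  have t3 : (∫ x : Eu N, ∫ y : Eu N,
      ‖fderiv ℝ u x - fderiv ℝ u y‖ ^ p / ‖x - y‖ ^ ((N : ℝ) + (s-1)*p)) ^ (1/p)
      ≤ 2 * B * ((2 * V * (N * (W * c))) ^ (1/p) * (1 + (M:ℝ)) ^ (1/p)) := by
    rw [← Real.mul_rpow (by positivity) (by positivity), ← root (2 * B) _ (by positivity) (by positivity)]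
    apply Real.rpow_le_rpow _ _ hc2.le
    · exact integral_nonneg fun x => integral_nonneg fun y => by positivity
    · refine (besov_double hN hp hs hM hτ (by linarith) hB (fderiv ℝ u) hd0 hd hh).trans ?_
      apply mul_le_mul_of_nonneg_left _ (by positivity)
      rw [mul_assoc (2 * V), mul_assoc (N:ℝ), mul_assoc W]
      apply mul_le_mul_of_nonneg_left _ (by positivity)
      apply mul_le_mul_of_nonneg_left _ (by positivity)
      apply mul_le_mul_of_nonneg_left _ (by positivity)
      rw [hc]
      have : 1 / (p / M) = (1 / p) * M := by field_simp
      rw [this]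
      nlinarith [mul_pos hc1 hM0]
  unfold besov
  have hone : 1 ≤ (1 + (M:ℝ)) ^ (1/p) := Real.one_le_rpow (by linarith) hc2.le
  have h5 : B * V ^ (1/p) ≤ B * V ^ (1/p) * (1 + (M:ℝ)) ^ (1/p) :=
    le_mul_of_one_le_right (by positivity) hone
  calc _ ≤ B * V ^ (1/p) + B * V ^ (1/p) + 2 * B * ((2 * V * (N * (W * c))) ^ (1/p) * (1 + (M:ℝ)) ^ (1/p)) :=
        add_le_add (add_le_add t1 t2) t3
    _ ≤ _ := by
        rw [show (2 * V ^ (1/p) + 2 * (2 * V * (N * (W * c))) ^ (1/p)) * B * (1 + (M:ℝ)) ^ (1/p)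
          = B * V ^ (1/p) * (1 + (M:ℝ)) ^ (1/p) + B * V ^ (1/p) * (1 + (M:ℝ)) ^ (1/p)
            + 2 * B * ((2 * V * (N * (W * c))) ^ (1/p) * (1 + (M:ℝ)) ^ (1/p)) by ring]
        linarith

end bes


section good
variable {N : ℕ}

/-- quantitative smoothness bounds -/
def Good (B τ : ℝ) (u : Eu N → ℝ) : Prop :=
  Differentiable ℝ u ∧ (∀ x, |u x| ≤ B) ∧ (∀ x, ‖fderiv ℝ u x‖ ≤ B) ∧
  (∀ x y, ‖fderiv ℝ u x - fderiv ℝ u y‖ ≤ B * ‖x - y‖ ^ τ)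

lemma Good.add' {B1 B2 τ : ℝ} {u w : Eu N → ℝ} (hu : Good B1 τ u) (hw : Good B2 τ w) :
    Good (B1 + B2) τ (fun x => u x + w x) := by
  obtain ⟨a1, a2, a3, a4⟩ := hu
  obtain ⟨b1, b2, b3, b4⟩ := hw
  have e : ∀ x, fderiv ℝ (fun x => u x + w x) x = fderiv ℝ u x + fderiv ℝ w x := fun x =>
    fderiv_fun_add (a1 x) (b1 x)
  refine ⟨a1.add b1, fun x => (abs_add_le _ _).trans (add_le_add (a2 x) (b2 x)), fun x => ?_,
    fun x y => ?_⟩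
  · rw [e]; exact (norm_add_le _ _).trans (add_le_add (a3 x) (b3 x))
  · rw [e, e, add_sub_add_comm, add_mul]
    exact (norm_add_le _ _).trans (add_le_add (a4 x y) (b4 x y))

lemma Good.sum' {ι : Type} [DecidableEq ι] (S : Finset ι) {B : ι → ℝ} {τ : ℝ} {u : ι → Eu N → ℝ}
    (hu : ∀ i, Good (B i) τ (u i)) : Good (∑ i ∈ S, B i) τ (fun x => ∑ i ∈ S, u i x) := by
  induction S using Finset.induction_on with
  | empty =>
    have : fderiv ℝ (fun _ : Eu N => (0:ℝ)) = 0 := by ext x; simp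
    simp only [Finset.sum_empty]
    refine ⟨differentiable_const _, by simp, by simp, by simp⟩
  | insert a S ha ih =>
    simp only [Finset.sum_insert ha]
    exact (hu a).add' ih

lemma good_prod (a : Eu N → ℝ) (ha : ContDiff ℝ (⊤ : ℕ∞) a) (hc : HasCompactSupport a)
    (L : Eu N →L[ℝ] ℝ) : ∃ D : ℝ, 0 ≤ D ∧ ∀ τ E : ℝ, 0 < τ → τ ≤ 1 → 0 ≤ E →
      ∀ v v1 : ℝ → ℝ, (∀ t, HasDerivAt v (v1 t) t) → (∀ t, |v t| ≤ E) → (∀ t, |v1 t| ≤ E) →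
      (∀ t s, |v1 t - v1 s| ≤ E * |t - s| ^ τ) → Good (D * E) τ (fun x => a x * v (L x)) := by
  have hd : ContDiff ℝ 1 (fderiv ℝ a) := ha.fderiv_right (WithTop.coe_le_coe.2 (le_top : (1 + 1 : ℕ∞) ≤ ⊤))
  have ha1 : ContDiff ℝ 1 a := ha.of_le (by exact_mod_cast le_top)
  have hdc : HasCompactSupport (fderiv ℝ a) := hc.fderiv ℝ
  obtain ⟨c0, hc0⟩ := ha.continuous.bounded_above_of_compact_support hc
  obtain ⟨c1, hc1⟩ := hd.continuous.bounded_above_of_compact_support hdc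
  obtain ⟨k0, hk0⟩ := ha1.lipschitzWith_of_hasCompactSupport hc one_ne_zero
  obtain ⟨k1, hk1⟩ := hd.lipschitzWith_of_hasCompactSupport hdc one_ne_zero
  have hc00 : 0 ≤ c0 := (norm_nonneg _).trans (hc0 0)
  have hc10 : 0 ≤ c1 := (norm_nonneg _).trans (hc1 0)
  set l := ‖L‖ with hl
  have hl0 : 0 ≤ l := norm_nonneg _
  set D := 2 * (c0 + c1 + c0 * l) + (k1 + c1 * l + k0 * l + c0 * (1 + l) * l) with hD
  have hk00 : 0 ≤ (k0:ℝ) := k0.2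
  have hk10 : 0 ≤ (k1:ℝ) := k1.2
  refine ⟨D, by positivity, ?_⟩
  intro τ E hτ0 hτ1 hE v v1 hv b0 b1 b2
  have hvL : ∀ x, HasFDerivAt (fun x => v (L x)) (v1 (L x) • L) x := fun x =>
    hasFDerivAt_comp_proj hv L x
  have hder : ∀ x, HasFDerivAt (fun x => a x * v (L x))
      (a x • (v1 (L x) • L) + v (L x) • fderiv ℝ a x) x := fun x =>
    ((ha1.differentiable one_ne_zero) x).hasFDerivAt.mul (hvL x)
  have bd : ∀ x, ‖a x • (v1 (L x) • L) + v (L x) • fderiv ℝ a x‖ ≤ (c0 * l + c1) * E := by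
    intro x
    calc _ ≤ ‖a x • (v1 (L x) • L)‖ + ‖v (L x) • fderiv ℝ a x‖ := norm_add_le _ _
      _ = ‖a x‖ * (|v1 (L x)| * l) + |v (L x)| * ‖fderiv ℝ a x‖ := by
          rw [norm_smul, norm_smul, norm_smul, Real.norm_eq_abs (v1 _), Real.norm_eq_abs (v _)]
      _ ≤ c0 * (E * l) + E * c1 := by
          gcongr
          · exact hc0 x
          · exact b1 _
          · exact b0 _
          · exact hc1 x
      _ = _ := by ring
  have hD1 : (c0 * l + c1) * E * 2 ≤ D * E := by
    rw [hD]
    have : 0 ≤ (2 * c0 + (k1 + c1 * l + k0 * l + c0 * (1 + l) * l)) * E := by positivity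
    nlinarith
  have hbd0 : 0 ≤ (c0 * l + c1) * E := by positivity
  refine ⟨fun x => (hder x).differentiableAt, fun x => ?_, fun x => ?_, fun x y => ?_⟩
  · rw [abs_mul]
    calc |a x| * |v (L x)| ≤ c0 * E := mul_le_mul (hc0 x) (b0 _) (abs_nonneg _) hc00
      _ ≤ D * E := by
        gcongr; rw [hD]
        have : 0 ≤ c0 + 2 * (c1 + c0 * l) + (k1 + c1 * l + k0 * l + c0 * (1 + l) * l) := by positivity
        linarith
  · rw [(hder x).fderiv]
    refine (bd x).trans ?_
    linarith
  · rw [(hder x).fderiv, (hder y).fderiv]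
    set r := ‖x - y‖ with hr
    have hr0 : 0 ≤ r := norm_nonneg _
    by_cases hr1 : r ≤ 1
    · have hrτ : r ≤ r ^ τ := by
        rcases eq_or_lt_of_le hr0 with h | h
        · rw [← h, Real.zero_rpow hτ0.ne']
        · calc r = r ^ (1:ℝ) := (Real.rpow_one r).symm
            _ ≤ r ^ τ := Real.rpow_le_rpow_of_exponent_ge h hr1 hτ1
      have hrτ0 : 0 ≤ r ^ τ := by positivity
      have hLxy : |L x - L y| ≤ l * r := by
        rw [← map_sub]; exact L.le_opNorm _
      have hLτ : |L x - L y| ^ τ ≤ (1 + l) * r ^ τ := by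
        calc |L x - L y| ^ τ ≤ ((1 + l) * r) ^ τ := by
              apply Real.rpow_le_rpow (abs_nonneg _) _ hτ0.le
              nlinarith
          _ = (1 + l) ^ τ * r ^ τ := Real.mul_rpow (by positivity) hr0
          _ ≤ (1 + l) * r ^ τ := by
              gcongr
              calc (1 + l) ^ τ ≤ (1 + l) ^ (1:ℝ) :=
                    Real.rpow_le_rpow_of_exponent_le (by linarith) hτ1
                _ = 1 + l := Real.rpow_one _
      have da : |a x - a y| ≤ k0 * r := by
        have := hk0.dist_le_mul x y
        rwa [Real.dist_eq, dist_eq_norm] at this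
      have dda : ‖fderiv ℝ a x - fderiv ℝ a y‖ ≤ k1 * r := by
        have := hk1.dist_le_mul x y
        rwa [dist_eq_norm, dist_eq_norm] at this
      have dv : |v (L x) - v (L y)| ≤ E * (l * r) := by
        have := Convex.norm_image_sub_le_of_norm_hasDerivWithin_le (f := v) (f' := v1) (C := E)
          (s := Set.univ) (fun t _ => (hv t).hasDerivWithinAt) (fun t _ => b1 t) convex_univ
          (Set.mem_univ (L y)) (Set.mem_univ (L x))
        rw [Real.norm_eq_abs, Real.norm_eq_abs] at this
        exact this.trans (by gcongr)
      have e : a x • (v1 (L x) • L) + v (L x) • fderiv ℝ a x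
          - (a y • (v1 (L y) • L) + v (L y) • fderiv ℝ a y)
          = ((a x - a y) * v1 (L x)) • L + (a y * (v1 (L x) - v1 (L y))) • L
            + v (L x) • (fderiv ℝ a x - fderiv ℝ a y) + (v (L x) - v (L y)) • fderiv ℝ a y := by
        module
      rw [e]
      calc _ ≤ ‖((a x - a y) * v1 (L x)) • L‖ + ‖(a y * (v1 (L x) - v1 (L y))) • L‖
            + ‖v (L x) • (fderiv ℝ a x - fderiv ℝ a y)‖ + ‖(v (L x) - v (L y)) • fderiv ℝ a y‖ :=
            norm_add₄_le
        _ = |a x - a y| * |v1 (L x)| * l + ‖a y‖ * |v1 (L x) - v1 (L y)| * l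
            + |v (L x)| * ‖fderiv ℝ a x - fderiv ℝ a y‖ + |v (L x) - v (L y)| * ‖fderiv ℝ a y‖ := by
            simp only [norm_smul, norm_mul, Real.norm_eq_abs, hl]
        _ ≤ (k0 * r) * E * l + c0 * (E * ((1 + l) * r ^ τ)) * l
            + E * (k1 * r) + (E * (l * r)) * c1 := by
            gcongr
            · exact b1 _
            · exact hc0 y
            · exact (b2 _ _).trans (by gcongr)
            · exact b0 _
            · exact hc1 y
        _ ≤ (k0 * r ^ τ) * E * l + c0 * (E * ((1 + l) * r ^ τ)) * l
            + E * (k1 * r ^ τ) + (E * (l * r ^ τ)) * c1 := by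
            gcongr
        _ ≤ D * E * r ^ τ := by
            rw [hD]
            have : 0 ≤ 2 * (c0 + c1 + c0 * l) * E * r ^ τ := by positivity
            nlinarith
    · push Not at hr1
      have h1 : 1 ≤ r ^ τ := Real.one_le_rpow hr1.le hτ0.le
      have h2 := norm_sub_le (a x • (v1 (L x) • L) + v (L x) • fderiv ℝ a x)
        (a y • (v1 (L y) • L) + v (L y) • fderiv ℝ a y)
      have h3 := bd x
      have h4 := bd y
      have h5 : 0 ≤ D * E := by linarith
      nlinarith

end good


section caseB

lemma hessDet_congr {N : ℕ} {u w : Eu N → ℝ} {x : Eu N} (h : u =ᶠ[nhds x] w) :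
    hessDet u x = hessDet w x := by
  unfold hessDet
  congr 2
  funext i j
  unfold pd2
  have h1 : (fun y => fderiv ℝ u y (ebasis j)) =ᶠ[nhds x] fun y => fderiv ℝ w y (ebasis j) := by
    filter_upwards [h.fderiv (𝕜 := ℝ)] with y hy
    rw [hy]
  rw [h1.fderiv_eq]

theorem caseB (N : ℕ) (hN : 3 ≤ N) (p s : ℝ) (hp : 1 < p) (hs1 : 1 < s) (hNp : (N:ℝ) < p)
    (hs : s ≤ 2 - 2 / (N:ℝ)) :
    ∃ (u : ℕ → Eu N → ℝ) (φ : Eu N → ℝ),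
      (∀ k, ContDiff ℝ (⊤ : ℕ∞) (u k)) ∧ (∀ k, HasCompactSupport (u k)) ∧
      ContDiff ℝ (⊤ : ℕ∞) φ ∧ HasCompactSupport φ ∧
      Tendsto (fun k => besov N s p (u k)) atTop (nhds 0) ∧
      Tendsto (fun k => ∫ x : Eu N, hessDet (u k) x * φ x) atTop atTop := by
  have hN0 : (0:ℝ) < N := by positivity
  have hN3 : (3:ℝ) ≤ N := by exact_mod_cast hN
  have hp0 : 0 < p := by linarith
  obtain ⟨z, o, hzo⟩ : ∃ z o : Fin N, o ≠ z :=
    ⟨⟨1, by omega⟩, ⟨0, by omega⟩, by simp⟩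
  set J := ((Finset.univ.erase z).erase o : Finset (Fin N)) with hJ
  let bump : ContDiffBump (0 : Eu N) :=
    ⟨8 * N + 1, 8 * N + 2, by positivity, by linarith⟩
  set χ : Eu N → ℝ := fun x => bump x with hχ
  have cχ : ContDiff ℝ (⊤ : ℕ∞) χ := bump.contDiff
  have sχ : HasCompactSupport χ := bump.hasCompactSupport
  have cz : ContDiff ℝ (⊤ : ℕ∞) (fun x : Eu N => x z) :=
    (EuclideanSpace.proj z : Eu N →L[ℝ] ℝ).contDiff
  obtain ⟨D1, hD1, g1⟩ := good_prod (fun x => χ x * x z) (cχ.mul cz) sχ.mul_right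
    (EuclideanSpace.proj o : Eu N →L[ℝ] ℝ)
  obtain ⟨D2, hD2, g2⟩ := good_prod (fun x => -(χ x * x z)) (cχ.mul cz).neg
    (sχ.mul_right (f' := fun x : Eu N => x z)).neg (TT z)
  have g3' := fun j : Fin N => good_prod (fun x => -(χ x)) cχ.neg sχ.neg
    (EuclideanSpace.proj j : Eu N →L[ℝ] ℝ)
  choose D3 hD3 g3 using g3'
  set D := D1 + (D2 + ∑ j ∈ J, D3 j) with hD
  have hD0 : 0 ≤ D := by
    have := Finset.sum_nonneg (fun j (_ : j ∈ J) => hD3 j)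
    positivity
  obtain ⟨C, hC, tvb⟩ := tv_bounds N hN
  obtain ⟨Cb, hCb, bes⟩ := besov_le N (by omega) p s (8 * N + 2) hp hs1
  set q := (1 / p + 1 / (N:ℝ)) / 2 with hq
  have hpN : 1 / p < 1 / (N:ℝ) := one_div_lt_one_div_of_lt hN0 hNp
  set v : ℕ → ℝ → ℝ := fun k => tv (N + k) (AA N (((N + k : ℕ) : ℝ) ^ (-q))) nn with hv
  set u : ℕ → Eu N → ℝ := fun k x => χ x * UU z o (v k) x with hu
  have hue : ∀ k, u k = fun x => (χ x * x z) * v k (x o) + ((-(χ x * x z)) * v k (TT z x)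
      + ∑ j ∈ J, (-(χ x)) * v k (x j)) := by
    intro k
    funext x
    simp only [hu, UU]
    rw [← Finset.mul_sum]
    ring
  have cv : ∀ k, ContDiff ℝ (⊤ : ℕ∞) (v k) := fun k => tv_contDiff _ _ _
  have cu : ∀ k, ContDiff ℝ (⊤ : ℕ∞) (u k) := by
    intro k
    apply cχ.mul
    unfold UU
    refine (cz.mul (((cv k).comp (EuclideanSpace.proj o : Eu N →L[ℝ] ℝ).contDiff).sub
      ((cv k).comp (TT z).contDiff))).sub (ContDiff.sum fun j _ => ?_)
    exact (cv k).comp (EuclideanSpace.proj j : Eu N →L[ℝ] ℝ).contDiff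
  have hMpos : ∀ k : ℕ, (0:ℝ) < ((N + k : ℕ) : ℝ) := fun k => by
    have : 0 < N + k := by omega
    exact_mod_cast this
  have hgood : ∀ k, Good (D * (C * ((N + k : ℕ) : ℝ) ^ (-q)))
      ((1 - 2 / (N:ℝ)) + 1 / ((N + k : ℕ) : ℝ)) (u k) := by
    intro k
    rw [hue]
    set ε := ((N + k : ℕ) : ℝ) ^ (-q) with hε
    have hε0 : 0 ≤ ε := by have := hMpos k; positivity
    set τ := (1 - 2 / (N:ℝ)) + 1 / ((N + k : ℕ) : ℝ) with hτ
    have h1N : 1 / ((N + k : ℕ) : ℝ) ≤ 1 / (N:ℝ) := by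
      apply one_div_le_one_div_of_le hN0
      push_cast; linarith [(Nat.cast_nonneg k : (0:ℝ) ≤ k)]
    have h1M : 0 < 1 / ((N + k : ℕ) : ℝ) := one_div_pos.2 (hMpos k)
    have h2N : 2 / (N:ℝ) = 2 * (1 / (N:ℝ)) := by ring
    have h3N : 3 * (1 / (N:ℝ)) ≤ 1 := by field_simp; linarith
    have hNpos : 0 < 1 / (N:ℝ) := by positivity
    have hτ0 : 0 < τ := by rw [hτ, h2N]; linarith
    have hτ1 : τ ≤ 1 := by rw [hτ, h2N]; linarith
    obtain ⟨b0, b1, b2⟩ := tvb (N + k) (by omega) ε hε0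
    have hd := tv_deriv (N + k) (AA N ε) nn
    have hE : 0 ≤ C * ε := by positivity
    have e : D * (C * ε) = D1 * (C * ε) + (D2 * (C * ε) + ∑ j ∈ J, D3 j * (C * ε)) := by
      rw [hD, ← Finset.sum_mul]; ring
    rw [e]
    exact (g1 τ _ hτ0 hτ1 hE _ _ hd b0 b1 b2).add' ((g2 τ _ hτ0 hτ1 hE _ _ hd b0 b1 b2).add'
      (Good.sum' J (fun j => g3 j τ _ hτ0 hτ1 hE _ _ hd b0 b1 b2)))
  have hbes : ∀ k, besov N s p (u k) ≤ Cb * (D * C) * (2:ℝ) ^ (1/p) * ((N + k : ℕ) : ℝ) ^ (-(q - 1/p)) := by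
    intro k
    obtain ⟨_, a2, a3, a4⟩ := hgood k
    have hM := hMpos k
    have hout : ∀ x : Eu N, 8 * (N:ℝ) + 2 < ‖x‖ → χ x = 0 := by
      intro x hx
      apply bump.zero_of_le_dist
      rw [dist_zero_right]
      exact hx.le
    have hB0 : 0 ≤ D * (C * ((N + k : ℕ) : ℝ) ^ (-q)) := by positivity
    have := bes (N + k) (by omega) ((1 - 2 / (N:ℝ)) + 1 / ((N + k : ℕ) : ℝ))
      (D * (C * ((N + k : ℕ) : ℝ) ^ (-q))) (by linarith) hB0 (u k)
      (fun x hx => by simp only [hu, hout x hx, zero_mul])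
      (fun x hx => by
        have : u k =ᶠ[nhds x] fun _ => 0 := by
          filter_upwards [(isOpen_lt continuous_const continuous_norm).mem_nhds hx] with y hy
          simp only [hu, hout y hy, zero_mul]
        rw [this.fderiv_eq]; simp) a2 a3 a4
    refine this.trans ?_
    have h1 : (1 + ((N + k : ℕ) : ℝ)) ^ (1/p) ≤ (2 * ((N + k : ℕ) : ℝ)) ^ (1/p) := by
      apply Real.rpow_le_rpow (by positivity) _ (by positivity)
      have : (1:ℝ) ≤ ((N + k : ℕ) : ℝ) := by
        have : 1 ≤ N + k := by omega
        exact_mod_cast this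
      linarith
    rw [Real.mul_rpow (by norm_num) hM.le] at h1
    calc Cb * (D * (C * ((N + k : ℕ) : ℝ) ^ (-q))) * (1 + ((N + k : ℕ) : ℝ)) ^ (1/p)
        ≤ Cb * (D * (C * ((N + k : ℕ) : ℝ) ^ (-q))) * ((2:ℝ) ^ (1/p) * ((N + k : ℕ) : ℝ) ^ (1/p)) := by
          gcongr
      _ = Cb * (D * C) * (2:ℝ) ^ (1/p) * (((N + k : ℕ) : ℝ) ^ (-q) * ((N + k : ℕ) : ℝ) ^ (1/p)) := by ring
      _ = _ := by
          rw [← Real.rpow_add hM]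
          congr 2
          ring
  have hbes0 : ∀ k, 0 ≤ besov N s p (u k) := by
    intro k
    unfold besov
    have i1 : 0 ≤ ∫ x : Eu N, |u k x| ^ p := integral_nonneg fun x => by positivity
    have i2 : 0 ≤ ∫ x : Eu N, ‖fderiv ℝ (u k) x‖ ^ p := integral_nonneg fun x => by positivity
    have i3 : 0 ≤ ∫ x : Eu N, ∫ y : Eu N,
      ‖fderiv ℝ (u k) x - fderiv ℝ (u k) y‖ ^ p / ‖x - y‖ ^ ((N : ℝ) + (s-1)*p) :=
      integral_nonneg fun x => integral_nonneg fun y => by positivity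
    positivity
  have hcast : Tendsto (fun k : ℕ => ((N + k : ℕ) : ℝ)) atTop atTop := by
    apply tendsto_natCast_atTop_atTop.comp
    exact tendsto_atTop_mono (fun k => Nat.le_add_left k N) tendsto_id
  refine ⟨u, phi, cu, fun k => sχ.mul_right, phi_contDiff, phi_hasCompactSupport, ?_, ?_⟩
  · apply squeeze_zero hbes0 hbes
    have h1 : Tendsto (fun k : ℕ => ((N + k : ℕ) : ℝ) ^ (-(q - 1/p))) atTop (nhds 0) :=
      (tendsto_rpow_neg_atTop (by rw [hq]; linarith)).comp hcast
    simpa using h1.const_mul (Cb * (D * C) * (2:ℝ) ^ (1/p))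
  · have hval : ∀ k, ∫ x : Eu N, hessDet (u k) x * phi x
        = 4 * π ^ N * ((N + k : ℕ) : ℝ) ^ (1 - q * N) := by
      intro k
      have hM := hMpos k
      have e1 : ∀ x, hessDet (u k) x * phi x = hessDet (UU z o (v k)) x * phi x := by
        intro x
        by_cases h0 : phi x = 0
        · rw [h0, mul_zero, mul_zero]
        · congr 1
          apply hessDet_congr
          have hx : ‖x‖ < 8 * N + 1 := by
            have := norm_le_of_coord (phi_ne h0)
            linarith
          filter_upwards [(isOpen_lt continuous_norm continuous_const).mem_nhds hx] with y hy
          have : χ y = 1 := by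
            apply bump.one_of_mem_closedBall
            rw [Metric.mem_closedBall, dist_zero_right]
            exact le_of_lt hy
          simp only [hu, this, one_mul]
      simp_rw [e1]
      rw [hv, integral_hessDet_UU (N + k) _ nn z o hzo hN nn_pos nn_inj]
      simp_rw [amp_term N hN]
      rw [Finset.sum_const, Finset.card_range, nsmul_eq_mul]
      rw [← Real.rpow_natCast, ← Real.rpow_mul hM.le, show 1 - q * (N:ℝ) = 1 + (-q * N) by ring,
        Real.rpow_add hM, Real.rpow_one]
      ring
    simp_rw [hval]
    apply Tendsto.const_mul_atTop (by positivity)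
    apply (tendsto_rpow_atTop _).comp hcast
    have : q * N < 1 := by
      have : q < 1 / (N:ℝ) := by rw [hq]; linarith
      calc q * N < 1 / (N:ℝ) * N := by gcongr
        _ = 1 := by field_simp
    linarith

end caseB


section radial
open Polynomial in
/-- radial profile and its derivatives -/
def rf (t : ℝ) : ℝ := expNegInvGlue (1 - t)
open Polynomial in
def rf1 (t : ℝ) : ℝ := -((X ^ 2 : ℝ[X]).eval (1 - t)⁻¹ * expNegInvGlue (1 - t))
open Polynomial in
def rf2 (t : ℝ) : ℝ :=
  (X ^ 2 * (X ^ 2 - derivative (R := ℝ) (X ^ 2)) : ℝ[X]).eval (1 - t)⁻¹ * expNegInvGlue (1 - t)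

lemma hasDerivAt_one_sub (t : ℝ) : HasDerivAt (fun t : ℝ => 1 - t) (-1) t := by
  simpa using (hasDerivAt_id t).const_sub 1

lemma rf_deriv (t : ℝ) : HasDerivAt rf (rf1 t) t := by
  have h := expNegInvGlue.hasDerivAt_polynomial_eval_inv_mul 1 (1 - t)
  have h2 : HasDerivAt expNegInvGlue
    ((Polynomial.X ^ 2 : Polynomial ℝ).eval (1 - t)⁻¹ * expNegInvGlue (1 - t)) (1 - t) := by
    simpa using h
  have := h2.comp t (hasDerivAt_one_sub t)
  exact this.congr_deriv (by unfold rf1; ring)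

lemma rf1_deriv (t : ℝ) : HasDerivAt rf1 (rf2 t) t := by
  have h := expNegInvGlue.hasDerivAt_polynomial_eval_inv_mul (Polynomial.X ^ 2) (1 - t)
  have := (h.comp t (hasDerivAt_one_sub t)).neg
  exact this.congr_deriv (by unfold rf2; ring)

lemma rf2_continuous : Continuous rf2 := by
  have := (expNegInvGlue.continuous_polynomial_eval_inv_mul
    (Polynomial.X ^ 2 * (Polynomial.X ^ 2 - Polynomial.derivative (Polynomial.X ^ 2)))).comp
    (continuous_const.sub continuous_id : Continuous fun t : ℝ => 1 - t)
  exact this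

lemma rf1_continuous : Continuous rf1 :=
  continuous_iff_continuousAt.2 fun t => (rf1_deriv t).continuousAt

lemma rf_contDiff : ContDiff ℝ (⊤ : ℕ∞) rf :=
  expNegInvGlue.contDiff.comp (contDiff_const.sub contDiff_id)

lemma rf_zero {t : ℝ} (h : 1 ≤ t) : rf t = 0 := expNegInvGlue.zero_of_nonpos (by linarith)
lemma rf1_zero {t : ℝ} (h : 1 ≤ t) : rf1 t = 0 := by
  unfold rf1; rw [expNegInvGlue.zero_of_nonpos (by linarith)]; simp
lemma rf1_neg {t : ℝ} (h : t < 1) : rf1 t < 0 := by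
  unfold rf1
  have h1 : 0 < 1 - t := by linarith
  have := expNegInvGlue.pos_of_pos h1
  simp only [Polynomial.eval_pow, Polynomial.eval_X]
  have : 0 < (1 - t)⁻¹ ^ 2 * expNegInvGlue (1 - t) := by positivity
  linarith

variable {N : ℕ}

/-- bump -/
def ps (x : Eu N) : ℝ := rf (‖x‖ ^ 2)

lemma ps_contDiff : ContDiff ℝ (⊤ : ℕ∞) (ps : Eu N → ℝ) :=
  rf_contDiff.comp (contDiff_norm_sq ℝ)

lemma ps_zero {x : Eu N} (h : 1 ≤ ‖x‖) : ps x = 0 := rf_zero (by nlinarith)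

lemma ps_hasCompactSupport : HasCompactSupport (ps : Eu N → ℝ) := by
  apply HasCompactSupport.of_support_subset_isCompact (isCompact_closedBall (0 : Eu N) 1)
  intro x hx
  rw [Metric.mem_closedBall, dist_zero_right]
  by_contra h
  exact hx (ps_zero (by linarith))

lemma pd_ps (j : Fin N) (x : Eu N) : fderiv ℝ ps x (ebasis j) = 2 * rf1 (‖x‖ ^ 2) * x j := by
  have h := (rf_deriv (‖x‖ ^ 2)).comp_hasFDerivAt x (hasStrictFDerivAt_norm_sq x).hasFDerivAt
  have e : fderiv ℝ ps x = rf1 (‖x‖ ^ 2) • (2 • innerSL ℝ x) := h.fderiv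
  rw [e]
  simp [ebasis, EuclideanSpace.inner_single_right]
  ring

lemma pd2_ps (i j : Fin N) (x : Eu N) :
    pd2 ps i j x = (if i = j then 2 * rf1 (‖x‖ ^ 2) else 0) + 4 * rf2 (‖x‖ ^ 2) * (x i * x j) := by
  unfold pd2
  simp_rw [pd_ps]
  have h := (rf1_deriv (‖x‖ ^ 2)).comp_hasFDerivAt x (hasStrictFDerivAt_norm_sq x).hasFDerivAt
  have h2 := (h.const_mul 2).mul (EuclideanSpace.proj j : Eu N →L[ℝ] ℝ).hasFDerivAt (x := x)
  have e := h2.fderiv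
  have e' : fderiv ℝ (fun y : Eu N => 2 * rf1 (‖y‖ ^ 2) * y j) x = _ := e
  rw [e']
  simp [ebasis, EuclideanSpace.inner_single_right]
  rcases eq_or_ne i j with h0 | h0
  · subst h0; simp; ring
  · simp [h0, h0.symm]; ring

lemma det_rank_one (hN : 2 ≤ N) (a b : ℝ) (v : Fin N → ℝ) :
    (Matrix.of fun i j => (if i = j then a else 0) + b * (v i * v j)).det
      = a ^ (N - 1) * (a + b * ∑ i, v i ^ 2) := by
  by_cases ha : a = 0
  · subst ha
    have : Nontrivial (Fin N) := Fin.nontrivial_iff_two_le.2 hN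
    have e : (Matrix.of fun i j => (if i = j then (0:ℝ) else 0) + b * (v i * v j))
        = Matrix.vecMulVec (fun i => b * v i) v := by
      ext i j; simp [Matrix.vecMulVec_apply]; ring
    rw [e, Matrix.det_vecMulVec, zero_pow (by omega), zero_mul]
  · have e : (Matrix.of fun i j => (if i = j then a else 0) + b * (v i * v j))
        = a • (1 + Matrix.replicateCol Unit (fun i => b / a * v i) * Matrix.replicateRow Unit v) := by
      ext i j
      simp [Matrix.mul_apply, Matrix.one_apply]
      split_ifs <;> field_simp <;> (try ring)
    rw [e, Matrix.det_smul, Matrix.det_one_add_replicateCol_mul_replicateRow]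
    simp only [Fintype.card_fin, dotProduct]
    obtain ⟨m, rfl⟩ : ∃ m, N = m + 1 := ⟨N - 1, by omega⟩
    have : ∑ i, v i * (b / a * v i) = b / a * ∑ i, v i ^ 2 := by
      rw [Finset.mul_sum]; apply Finset.sum_congr rfl; intro i _; ring
    rw [this, Nat.add_sub_cancel, pow_succ]
    field_simp

lemma hessDet_ps (hN : 2 ≤ N) (x : Eu N) : hessDet ps x =
    (2 * rf1 (‖x‖ ^ 2)) ^ (N - 1) * (2 * rf1 (‖x‖ ^ 2) + 4 * rf2 (‖x‖ ^ 2) * ‖x‖ ^ 2) := by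
  unfold hessDet
  simp_rw [pd2_ps]
  rw [det_rank_one hN, EuclideanSpace.norm_sq_eq x]
  simp

lemma hessDet_ps_zero (hN : 2 ≤ N) {x : Eu N} (h : 1 ≤ ‖x‖) : hessDet ps x = 0 := by
  rw [hessDet_ps hN, rf1_zero (by nlinarith), mul_zero, zero_pow (by omega), zero_mul]

lemma const_ne (hN : 2 ≤ N) : ∫ x : Eu N, hessDet ps x * ‖x‖ ^ 2 ≠ 0 := by
  have : Nonempty (Fin N) := ⟨⟨0, by omega⟩⟩
  have : Nontrivial (Eu N) := inferInstance
  have hfr : Module.finrank ℝ (Eu N) = N := by simp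
  simp_rw [hessDet_ps hN]
  rw [integral_fun_norm_addHaar volume (fun r : ℝ => (2 * rf1 (r ^ 2)) ^ (N - 1) *
    (2 * rf1 (r ^ 2) + 4 * rf2 (r ^ 2) * r ^ 2) * r ^ 2), hfr]
  have hvol : volume.real (Metric.ball (0 : Eu N) 1) ≠ 0 := by
    have h1 : 0 < volume (Metric.ball (0 : Eu N) 1) := Metric.measure_ball_pos _ _ one_pos
    have h2 : volume (Metric.ball (0 : Eu N) 1) ≠ ⊤ := measure_ball_lt_top.ne
    exact (ENNReal.toReal_pos h1.ne' h2).ne'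
  simp only [nsmul_eq_mul, smul_eq_mul]
  refine mul_ne_zero (by positivity) (mul_ne_zero hvol ?_)
  -- the one-dimensional function
  set h : ℝ → ℝ := fun r => 2 * rf1 (r ^ 2) * r with hh
  set h' : ℝ → ℝ := fun r => 2 * rf1 (r ^ 2) + 4 * rf2 (r ^ 2) * r ^ 2 with hh'
  have hd : ∀ r, HasDerivAt h (h' r) r := by
    intro r
    have h1 := (rf1_deriv (r ^ 2)).comp r (hasDerivAt_pow 2 r)
    have h2 := (h1.const_mul 2).mul (hasDerivAt_id r)
    exact h2.congr_deriv (by simp [hh']; ring)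
  have c1 : Continuous h := continuous_iff_continuousAt.2 fun r => (hd r).continuousAt
  have c2 : Continuous h' := by
    have a := rf1_continuous
    have b := rf2_continuous
    fun_prop
  have e1 : ∀ r : ℝ, r ^ (N - 1) * ((2 * rf1 (r ^ 2)) ^ (N - 1) *
      (2 * rf1 (r ^ 2) + 4 * rf2 (r ^ 2) * r ^ 2) * r ^ 2) = h r ^ (N - 1) * h' r * r ^ 2 := by
    intro r
    simp only [hh, hh', mul_pow]
    ring
  simp_rw [e1]
  have hz : ∀ r, 1 ≤ r → h r = 0 := by
    intro r hr
    simp only [hh]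
    rw [rf1_zero (by nlinarith)]; ring
  have e2 : ∫ r in Set.Ioi (0:ℝ), h r ^ (N - 1) * h' r * r ^ 2
      = ∫ r in (0:ℝ)..1, h r ^ (N - 1) * h' r * r ^ 2 := by
    rw [intervalIntegral.integral_of_le zero_le_one]
    apply setIntegral_eq_of_subset_of_forall_sdiff_eq_zero measurableSet_Ioi Set.Ioc_subset_Ioi_self
    intro r hr
    have : 1 ≤ r := by
      by_contra hc
      exact hr.2 ⟨hr.1, by linarith⟩
    rw [hz r this, zero_pow (by omega)]; ring
  rw [e2]
  have ftc : ∫ r in (0:ℝ)..1, (N * (h r ^ (N - 1) * h' r * r ^ 2) + 2 * (h r ^ N * r)) = 0 := by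
    have hder : ∀ r ∈ Set.uIcc (0:ℝ) 1, HasDerivAt (fun r => h r ^ N * r ^ 2)
        (N * (h r ^ (N - 1) * h' r * r ^ 2) + 2 * (h r ^ N * r)) r := by
      intro r _
      have := ((hd r).pow N).mul (hasDerivAt_pow 2 r)
      exact this.congr_deriv (by simp; ring)
    rw [intervalIntegral.integral_eq_sub_of_hasDerivAt hder
      (Continuous.intervalIntegrable (by fun_prop) _ _), hz 1 le_rfl]
    rw [zero_pow (by omega : N ≠ 0)]; simp
  rw [intervalIntegral.integral_add (Continuous.intervalIntegrable (by fun_prop) _ _)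
    (Continuous.intervalIntegrable (by fun_prop) _ _), intervalIntegral.integral_const_mul,
    intervalIntegral.integral_const_mul] at ftc
  have pos : 0 < ∫ r in (0:ℝ)..1, (-h r) ^ N * r := by
    apply intervalIntegral.intervalIntegral_pos_of_pos_on
      (Continuous.intervalIntegrable (by fun_prop) _ _) _ one_pos
    intro r hr
    have h1 : rf1 (r ^ 2) < 0 := rf1_neg (by nlinarith [hr.1, hr.2])
    have h2 : 0 < -h r := by
      simp only [hh]
      nlinarith [mul_pos (neg_pos.2 h1) hr.1]
    have := hr.1
    positivity
  have e3 : ∫ r in (0:ℝ)..1, (-h r) ^ N * r = (-1) ^ N * ∫ r in (0:ℝ)..1, h r ^ N * r := by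
    rw [← intervalIntegral.integral_const_mul]
    congr 1
    funext r
    rw [neg_pow]; ring
  intro h0
  rw [h0] at ftc
  have : ∫ r in (0:ℝ)..1, h r ^ N * r = 0 := by linarith
  rw [e3, this, mul_zero] at pos
  exact lt_irrefl _ pos

end radial


section caseA
variable {N : ℕ}

lemma fderiv_scale (w : Eu N → ℝ) (c l : ℝ) (hw : Differentiable ℝ w) (x : Eu N) :
    fderiv ℝ (fun x => c * w (l • x)) x = (c * l) • fderiv ℝ w (l • x) := by
  have h1 : HasFDerivAt (fun x : Eu N => l • x) (l • ContinuousLinearMap.id ℝ (Eu N)) x :=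
    (hasFDerivAt_id x).const_smul l
  have h2 := ((hw (l • x)).hasFDerivAt.comp x h1).const_mul c
  have h3 : fderiv ℝ (fun x => c * w (l • x)) x = _ := h2.fderiv
  rw [h3]
  ext v
  simp
  ring

lemma hessDet_scale (w : Eu N → ℝ) (c l : ℝ) (hw : ContDiff ℝ (⊤ : ℕ∞) w) (x : Eu N) :
    hessDet (fun x => c * w (l • x)) x = (c * l ^ 2) ^ N * hessDet w (l • x) := by
  unfold hessDet
  have hd : Differentiable ℝ w := hw.differentiable (by simp)
  have e : (Matrix.of fun i j => pd2 (fun x => c * w (l • x)) i j x)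
      = (c * l ^ 2) • (Matrix.of fun i j => pd2 w i j (l • x)) := by
    ext i j
    simp only [Matrix.of_apply, Matrix.smul_apply, smul_eq_mul, pd2]
    simp_rw [fderiv_scale w c l hd]
    simp only [smul_apply, smul_eq_mul]
    have hd2 : Differentiable ℝ (fun y => fderiv ℝ w y (ebasis j)) := by
      have : ContDiff ℝ 1 (fun y => fderiv ℝ w y) := hw.fderiv_right (by norm_cast)
      exact (this.differentiable (by simp)).clm_apply (differentiable_const _)
    rw [fderiv_scale (fun y => fderiv ℝ w y (ebasis j)) (c * l) l hd2]
    simp only [smul_apply, smul_eq_mul]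
    ring
  rw [e, Matrix.det_smul]
  simp

lemma besov_scale (s p c l : ℝ) (hp : 1 < p) (hc : 0 < c) (hl : 0 < l)
    (w : Eu N → ℝ) (hw : ContDiff ℝ (⊤ : ℕ∞) w) :
    ∃ A B C : ℝ, (A = (∫ x : Eu N, |w x| ^ p) ^ (1/p) ∧
      B = (∫ x : Eu N, ‖fderiv ℝ w x‖ ^ p) ^ (1/p) ∧
      C = (∫ x : Eu N, ∫ y : Eu N,
      ‖fderiv ℝ w x - fderiv ℝ w y‖ ^ p / ‖x - y‖ ^ ((N : ℝ) + (s-1)*p)) ^ (1/p)) ∧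
    besov N s p (fun x => c * w (l • x)) =
      c * l ^ (-(N:ℝ)/p) * A + c * l ^ (1 - (N:ℝ)/p) * B + c * l ^ (s - (N:ℝ)/p) * C := by
  refine ⟨_, _, _, ⟨rfl, rfl, rfl⟩, ?_⟩
  have hd : Differentiable ℝ w := hw.differentiable (by simp)
  have hfr : Module.finrank ℝ (Eu N) = N := by simp
  have hp0 : 0 < p := by linarith
  have key : ∀ f : Eu N → ℝ, ∫ x, f (l • x) = l ^ (-(N:ℝ)) * ∫ x, f x := by
    intro f
    rw [Measure.integral_comp_smul, hfr, smul_eq_mul, abs_of_pos (by positivity),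
      Real.rpow_neg hl.le, Real.rpow_natCast]
  have root : ∀ (a e I : ℝ), 0 < a → 0 ≤ I →
      (a ^ p * l ^ e * I) ^ (1/p) = a * l ^ (e / p) * I ^ (1/p) := by
    intro a e I ha hI
    rw [Real.mul_rpow (by positivity) hI, Real.mul_rpow (by positivity) (by positivity),
      ← Real.rpow_mul ha.le, ← Real.rpow_mul hl.le, mul_one_div_cancel hp0.ne', Real.rpow_one,
      mul_one_div]
  unfold besov
  simp_rw [fderiv_scale w c l hd]
  congr 1
  congr 1
  · have e1 : ∀ x : Eu N, |c * w (l • x)| ^ p = c ^ p * |w (l • x)| ^ p := by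
      intro x
      rw [abs_mul, abs_of_pos hc, Real.mul_rpow hc.le (abs_nonneg _)]
    simp_rw [e1]
    rw [integral_const_mul, key (fun x => |w x| ^ p), ← mul_assoc,
      root c _ _ hc (integral_nonneg fun x => by positivity)]
  · have e1 : ∀ x : Eu N, ‖(c * l) • fderiv ℝ w (l • x)‖ ^ p
        = (c * l) ^ p * ‖fderiv ℝ w (l • x)‖ ^ p := by
      intro x
      rw [norm_smul, Real.norm_of_nonneg (by positivity),
        Real.mul_rpow (by positivity) (norm_nonneg _)]
    simp_rw [e1]
    rw [integral_const_mul, key (fun x => ‖fderiv ℝ w x‖ ^ p), ← mul_assoc,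
      root (c * l) _ _ (by positivity) (integral_nonneg fun x => by positivity),
      sub_eq_add_neg, Real.rpow_add hl, Real.rpow_one, neg_div]
    ring
  · set q : ℝ := (N : ℝ) + (s-1)*p with hq
    have e1 : ∀ x y : Eu N,
        ‖(c * l) • fderiv ℝ w (l • x) - (c * l) • fderiv ℝ w (l • y)‖ ^ p / ‖x - y‖ ^ q
        = (c * l) ^ p * l ^ q *
          (‖fderiv ℝ w (l • x) - fderiv ℝ w (l • y)‖ ^ p / ‖l • x - l • y‖ ^ q) := by
      intro x y
      rw [← smul_sub, ← smul_sub, norm_smul, norm_smul, Real.norm_of_nonneg (by positivity),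
        Real.norm_of_nonneg hl.le, Real.mul_rpow (by positivity) (norm_nonneg _),
        Real.mul_rpow hl.le (norm_nonneg _)]
      have := (Real.rpow_pos_of_pos hl q).ne'
      field_simp
    simp_rw [e1]
    simp_rw [integral_const_mul]
    have e2 : ∀ x : Eu N, ∫ y : Eu N,
        ‖fderiv ℝ w (l • x) - fderiv ℝ w (l • y)‖ ^ p / ‖l • x - l • y‖ ^ q
        = l ^ (-(N:ℝ)) * ∫ y : Eu N,
          ‖fderiv ℝ w (l • x) - fderiv ℝ w y‖ ^ p / ‖l • x - y‖ ^ q := fun x =>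
      key (fun y => ‖fderiv ℝ w (l • x) - fderiv ℝ w y‖ ^ p / ‖l • x - y‖ ^ q)
    simp_rw [e2, integral_const_mul]
    rw [key (fun x => ∫ y : Eu N, ‖fderiv ℝ w x - fderiv ℝ w y‖ ^ p / ‖x - y‖ ^ q)]
    have e3 : ∀ I : ℝ, (c * l) ^ p * l ^ q * (l ^ (-(N:ℝ)) * (l ^ (-(N:ℝ)) * I))
        = (c * l) ^ p * l ^ (q + -(N:ℝ) + -(N:ℝ)) * I := by
      intro I
      rw [Real.rpow_add hl (q + -(N:ℝ)) (-(N:ℝ)), Real.rpow_add hl q (-(N:ℝ))]; ring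
    rw [e3, root (c * l) _ _ (by positivity)
      (integral_nonneg fun x => integral_nonneg fun y => by positivity)]
    have e4 : s - (N:ℝ)/p = 1 + (q + -(N:ℝ) + -(N:ℝ)) / p := by
      rw [hq]; field_simp; ring
    rw [e4, Real.rpow_add hl, Real.rpow_one]
    ring

theorem caseA (N : ℕ) (hN : 3 ≤ N) (p s : ℝ) (hp : 1 < p) (hs1 : 1 < s)
    (hs : s + 2/(N:ℝ) < 1 + (N:ℝ)/p) :
    ∃ (u : ℕ → Eu N → ℝ) (φ : Eu N → ℝ),
      (∀ k, ContDiff ℝ (⊤ : ℕ∞) (u k)) ∧ (∀ k, HasCompactSupport (u k)) ∧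
      ContDiff ℝ (⊤ : ℕ∞) φ ∧ HasCompactSupport φ ∧
      Tendsto (fun k => besov N s p (u k)) atTop (nhds 0) ∧
      Tendsto (fun k => ∫ x : Eu N, hessDet (u k) x * φ x) atTop atTop := by
  obtain ⟨α, h1, h2⟩ := exists_between (show s - (N:ℝ)/p < 1 - 2/(N:ℝ) by linarith)
  have hN0 : (0:ℝ) < N := by exact_mod_cast (by omega : 0 < N)
  have hp0 : 0 < p := by linarith
  have hfr : Module.finrank ℝ (Eu N) = N := by simp
  set L : ℕ → ℝ := fun k => (k:ℝ) + 1 with hL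
  have hLpos : ∀ k, 0 < L k := fun k => by simp only [hL]; positivity
  have hL1 : ∀ k, 1 ≤ L k := fun k => by simp only [hL]; linarith [(Nat.cast_nonneg k : (0:ℝ) ≤ k)]
  have hLtop : Tendsto L atTop atTop := tendsto_atTop_add_const_right _ _ tendsto_natCast_atTop_atTop
  set C : ℝ := ∫ x : Eu N, hessDet ps x * ‖x‖ ^ 2 with hC
  have hC0 : C ≠ 0 := const_ne (by omega)
  let χ : ContDiffBump (0 : Eu N) := ⟨1, 2, one_pos, one_lt_two⟩
  refine ⟨fun k x => L k ^ (-α) * ps (L k • x), fun x => C * ‖x‖ ^ 2 * χ x, ?_, ?_, ?_, ?_, ?_, ?_⟩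
  · intro k
    exact contDiff_const.mul (ps_contDiff.comp (contDiff_const_smul (L k)))
  · intro k
    apply HasCompactSupport.mul_left
    exact (ps_hasCompactSupport (N := N)).comp_smul (hLpos k).ne'
  · exact (contDiff_const.mul (contDiff_norm_sq ℝ)).mul χ.contDiff
  · exact χ.hasCompactSupport.mul_left
  · choose A B D hABD hb using fun k =>
      besov_scale s p (L k ^ (-α)) (L k) hp (Real.rpow_pos_of_pos (hLpos k) _) (hLpos k)
        (ps : Eu N → ℝ) ps_contDiff
    have t : ∀ e I : ℝ, e < 0 → Tendsto (fun k => L k ^ e * I) atTop (nhds 0) := by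
      intro e I he
      have h := (tendsto_rpow_neg_atTop (neg_pos.2 he)).comp hLtop
      have h' := h.mul_const I
      simpa [Function.comp_def] using h'
    have hh := ((t (-α + -(N:ℝ)/p) ((∫ x : Eu N, |ps x| ^ p) ^ (1/p))
        (by rw [neg_div]; linarith)).add
      (t (-α + (1 - (N:ℝ)/p)) ((∫ x : Eu N, ‖fderiv ℝ ps x‖ ^ p) ^ (1/p)) (by linarith))).add
      (t (-α + (s - (N:ℝ)/p)) ((∫ x : Eu N, ∫ y : Eu N,
      ‖fderiv ℝ ps x - fderiv ℝ ps y‖ ^ p / ‖x - y‖ ^ ((N : ℝ) + (s-1)*p)) ^ (1/p)) (by linarith))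
    rw [add_zero, add_zero] at hh
    refine hh.congr fun k => ?_
    rw [hb k, (hABD k).1, (hABD k).2.1, (hABD k).2.2, Real.rpow_add (hLpos k),
      Real.rpow_add (hLpos k), Real.rpow_add (hLpos k)]
  · have e : ∀ k, ∫ x : Eu N, hessDet (fun x => L k ^ (-α) * ps (L k • x)) x * (C * ‖x‖ ^ 2 * χ x)
        = C ^ 2 * L k ^ ((N:ℝ) * (1 - α) - 2) := by
      intro k
      have hl := hLpos k
      have e1 : ∀ x : Eu N, hessDet (fun x => L k ^ (-α) * ps (L k • x)) x * (C * ‖x‖ ^ 2 * χ x)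
          = ((L k ^ (-α) * L k ^ 2) ^ N * C * (L k ^ 2)⁻¹) *
            (hessDet ps (L k • x) * ‖L k • x‖ ^ 2) := by
        intro x
        rw [hessDet_scale _ _ _ ps_contDiff]
        by_cases hx : 1 ≤ ‖L k • x‖
        · rw [hessDet_ps_zero (by omega) hx]; ring
        · have hx1 : χ x = 1 := by
            apply χ.one_of_mem_closedBall
            rw [Metric.mem_closedBall, dist_zero_right]
            rw [norm_smul, Real.norm_of_nonneg hl.le] at hx
            have := hL1 k
            change ‖x‖ ≤ 1
            nlinarith [norm_nonneg x]
          rw [hx1, norm_smul, Real.norm_of_nonneg hl.le]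
          field_simp
      simp_rw [e1]
      rw [integral_const_mul, Measure.integral_comp_smul volume
        (fun x : Eu N => hessDet ps x * ‖x‖ ^ 2), hfr, ← hC, smul_eq_mul,
        abs_of_pos (by positivity)]
      have e5 : L k ^ ((N:ℝ) * (1 - α) - 2) = (L k ^ (-α) * L k ^ 2) ^ N * (L k ^ 2)⁻¹ * (L k ^ N)⁻¹ := by
        rw [← Real.rpow_natCast (L k) 2, ← Real.rpow_natCast (L k) N, ← Real.rpow_add hl,
          ← Real.rpow_natCast _ N, ← Real.rpow_mul hl.le, ← Real.rpow_neg hl.le,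
          ← Real.rpow_neg hl.le, ← Real.rpow_add hl, ← Real.rpow_add hl]
        congr 1
        push_cast
        ring
      rw [e5]
      ring
    simp_rw [e]
    apply Tendsto.const_mul_atTop (by positivity)
    refine (tendsto_rpow_atTop ?_).comp hLtop
    have : 2 / (N:ℝ) < 1 - α := by linarith
    rw [div_lt_iff₀ hN0] at this
    linarith

end caseA

/-- Theorem (optimality in the scale `B(s,p)`): whenever `B(s,p)` fails to embed locally
into `B(2-2/N, N)`, continuity of the Hessian determinant fails. -/
theorem stmt2 (N : ℕ) (hN : 3 ≤ N) (p s : ℝ) (hp : 1 < p) (hs1 : 1 < s) (hs2 : s < 2)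
    (hcond : s + 2/(N:ℝ) < 1 + max 1 ((N:ℝ)/p) ∨
      (s + 2/(N:ℝ) = 1 + max 1 ((N:ℝ)/p) ∧ (N:ℝ) < p)) :
    ∃ (u : ℕ → Eu N → ℝ) (φ : Eu N → ℝ),
      (∀ k, ContDiff ℝ (⊤ : ℕ∞) (u k)) ∧ (∀ k, HasCompactSupport (u k)) ∧
      ContDiff ℝ (⊤ : ℕ∞) φ ∧ HasCompactSupport φ ∧
      Tendsto (fun k => besov N s p (u k)) atTop (nhds 0) ∧
      Tendsto (fun k => ∫ x : Eu N, hessDet (u k) x * φ x) atTop atTop := by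
  have hp0 : 0 < p := by linarith
  rcases le_or_gt p (N:ℝ) with h | h
  · have h1 : 1 ≤ (N:ℝ)/p := (one_le_div hp0).2 h
    rw [max_eq_right h1] at hcond
    rcases hcond with hc | ⟨_, hc⟩
    · exact caseA N hN p s hp hs1 hc
    · exact absurd hc (not_lt.2 h)
  · have h1 : (N:ℝ)/p ≤ 1 := (div_le_one hp0).2 h.le
    rw [max_eq_left h1] at hcond
    refine caseB N hN p s hp hs1 h ?_
    rcases hcond with hc | ⟨hc, _⟩ <;> linarith
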